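/- arXiv:2402.07176 — 3 statements merged into one kernel-verified Lean document; each statement's English description precedes it below -/
import Mathlib

section
/- As x → ∞, the average of d_n/log p_n tends to 1; precisely, lim_{x→∞} (1/x) · ∑_{n ≤ x} (p_{n+1} − p_n)/log p_n = 1, where the sum is over natural numbers n with 1 ≤ n ≤ x. -/
open Real Filter

/-- `nthPrime n` is the `n`-th prime number `p_n` (so `p_1 = 2`, `p_2 = 3`, ...). -/
noncomputable def nthPrime (n : ℕ) : ℕ := Nat.nth Nat.Prime (n - 1)

open MeasureTheory Topology in
theorem pg_smoothing (F : ℝ → ℝ) (C : ℝ) (hFm : Measurable F) (hFb : ∀ u, |F u| ≤ C)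
    (hF0 : ∀ u ≤ 0, F u = 0) (G : ℝ → ℝ → ℂ)
    (hG : ContinuousOn (fun p : ℝ × ℝ => G p.1 p.2) {p | 0 ≤ p.1})
    (hFG : ∀ σ : ℝ, 0 < σ → ∀ t : ℝ, ∫ u : ℝ, (F u : ℂ) * Complex.exp (-((σ : ℂ) + t * Complex.I) * u) = G σ t)
    (φ : ℝ → ℂ) (hφ : Continuous φ) (hφc : HasCompactSupport φ)
    (K : ℝ → ℂ) (hK : Integrable K)
    (hKφ : ∀ v : ℝ, ∫ t : ℝ, φ t * Complex.exp (-(t * v * Complex.I)) = K v) :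
    Tendsto (fun y : ℝ => ∫ u : ℝ, (F u : ℂ) * K (u - y)) atTop (𝓝 0) := by
  have hC : 0 ≤ C := (abs_nonneg _).trans (hFb 0)
  have hφi : Integrable φ := hφ.integrable_of_hasCompactSupport hφc
  -- integrability of the damped function
  have hFi : ∀ σ > 0, Integrable (fun u : ℝ => (F u : ℂ) * Complex.exp (-(σ * u : ℝ))) := by
    intro σ hσ
    have h1 : Integrable ((Set.Ioi (0:ℝ)).indicator (fun u : ℝ => C * Real.exp (-σ * u))) := by
      rw [integrable_indicator_iff measurableSet_Ioi]
      exact (exp_neg_integrableOn_Ioi 0 hσ).const_mul C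
    refine h1.mono' (by fun_prop) (Eventually.of_forall fun u => ?_)
    by_cases hu : 0 < u
    · rw [Set.indicator_of_mem (by exact hu), norm_mul, Complex.norm_real, ← Complex.ofReal_neg,
        ← Complex.ofReal_exp, Complex.norm_real, Real.norm_eq_abs, Real.norm_eq_abs,
        abs_of_pos (Real.exp_pos _), neg_mul]
      gcongr
      exact hFb u
    · rw [Set.indicator_of_notMem (by simpa using hu), hF0 u (not_lt.1 hu)]
      simp
  have key : ∀ y : ℝ, ∫ u : ℝ, (F u : ℂ) * K (u - y) =
      ∫ t : ℝ, φ t * Complex.exp (t * y * Complex.I) * G 0 t := by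
    intro y
    have hA : Tendsto (fun σ : ℝ => ∫ u : ℝ, (F u : ℂ) * Complex.exp (-(σ * u : ℝ)) * K (u - y))
        (𝓝[>] 0) (𝓝 (∫ u : ℝ, (F u : ℂ) * K (u - y))) := by
      refine tendsto_integral_filter_of_dominated_convergence (fun u => C * ‖K (u - y)‖) ?_ ?_ ?_ ?_
      · refine Eventually.of_forall fun σ => ?_
        have := (hK.comp_sub_right y).aestronglyMeasurable
        refine AEStronglyMeasurable.mul ?_ this
        exact Measurable.aestronglyMeasurable (by fun_prop)
      · filter_upwards [self_mem_nhdsWithin] with σ hσ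
        refine Eventually.of_forall fun u => ?_
        rw [norm_mul, norm_mul]
        gcongr
        by_cases hu : 0 < u
        · rw [Complex.norm_real, ← Complex.ofReal_neg,
            ← Complex.ofReal_exp, Complex.norm_real, Real.norm_eq_abs, Real.norm_eq_abs,
            abs_of_pos (Real.exp_pos _)]
          have h2 : Real.exp (-(σ * u)) ≤ 1 := by
            rw [Real.exp_le_one_iff]
            have : 0 < σ * u := mul_pos hσ hu
            linarith
          calc _ ≤ C * 1 := by gcongr; exact hFb u
            _ = C := mul_one C
        · rw [hF0 u (not_lt.1 hu)]
          simpa using hC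
      · exact (hK.comp_sub_right y).norm.const_mul C
      · refine Eventually.of_forall fun u => ?_
        have : Continuous fun σ : ℝ => (F u : ℂ) * Complex.exp (-(σ * u : ℝ)) * K (u - y) := by
          fun_prop
        have h := (this.tendsto 0).mono_left (nhdsWithin_le_nhds (s := Set.Ioi 0))
        simpa using h
    have hB : Tendsto (fun σ : ℝ => ∫ t : ℝ, φ t * Complex.exp (t * y * Complex.I) * G σ t)
        (𝓝[>] 0) (𝓝 (∫ t : ℝ, φ t * Complex.exp (t * y * Complex.I) * G 0 t)) := by
      have hcomp : IsCompact (Set.Icc (0:ℝ) 1 ×ˢ tsupport φ) := isCompact_Icc.prod hφc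
      obtain ⟨M, hM⟩ := hcomp.exists_bound_of_continuousOn (f := fun p : ℝ × ℝ => G p.1 p.2)
        (hG.mono fun p hp => hp.1.1)
      have hGt : ∀ σ ≥ 0, Continuous fun t => G σ t := by
        intro σ hσ
        have : ContinuousOn (fun t : ℝ => G σ t) Set.univ :=
          hG.comp (f := fun t : ℝ => (σ, t)) (by fun_prop) (fun t _ => hσ)
        simpa [continuousOn_univ] using this
      refine tendsto_integral_filter_of_dominated_convergence (fun t => ‖φ t‖ * M) ?_ ?_ ?_ ?_
      · filter_upwards [self_mem_nhdsWithin] with σ hσ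
        have := hGt σ (le_of_lt hσ)
        exact Continuous.aestronglyMeasurable (by fun_prop)
      · filter_upwards [self_mem_nhdsWithin, Ioc_mem_nhdsGT (zero_lt_one' ℝ)] with σ hσ hσ1
        refine Eventually.of_forall fun t => ?_
        rw [norm_mul, norm_mul]
        have : ‖Complex.exp (t * y * Complex.I)‖ = 1 := by
          rw [← Complex.ofReal_mul, Complex.norm_exp_ofReal_mul_I]
        rw [this, mul_one]
        by_cases ht : φ t = 0
        · simp [ht]
        · gcongr
          exact hM (σ, t) ⟨⟨hσ1.1.le, hσ1.2⟩, subset_tsupport _ ht⟩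
      · exact hφi.norm.mul_const M
      · refine Eventually.of_forall fun t => ?_
        refine Tendsto.mul tendsto_const_nhds ?_
        have h0 : ContinuousOn (fun σ : ℝ => G σ t) (Set.Ici 0) :=
          hG.comp (f := fun σ : ℝ => (σ, t)) (by fun_prop) (fun σ hσ => hσ)
        exact (h0 0 Set.self_mem_Ici).mono_left (nhdsWithin_mono _ Set.Ioi_subset_Ici_self)
    refine tendsto_nhds_unique hA (hB.congr' ?_)
    filter_upwards [self_mem_nhdsWithin] with σ hσ
    have hσ : 0 < σ := hσ
    symm
    have e1 : ∀ u : ℝ, (F u : ℂ) * Complex.exp (-(σ * u : ℝ)) * K (u - y) =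
        ∫ t : ℝ, ((F u : ℂ) * Complex.exp (-(σ * u : ℝ))) * φ t *
          Complex.exp (-(t * (u - y) * Complex.I)) := by
      intro u
      rw [← hKφ, ← integral_const_mul]
      congr 1; ext t
      push_cast; ring
    have e2 : ∀ t : ℝ, φ t * Complex.exp (t * y * Complex.I) * G σ t =
        ∫ u : ℝ, ((F u : ℂ) * Complex.exp (-(σ * u : ℝ))) * φ t *
          Complex.exp (-(t * (u - y) * Complex.I)) := by
      intro t
      rw [← hFG σ hσ, ← integral_const_mul]
      congr 1; ext u
      have : Complex.exp (t * y * Complex.I) * Complex.exp (-((σ : ℂ) + t * Complex.I) * u) =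
        Complex.exp (-(σ * u : ℝ)) * Complex.exp (-(t * (u - y) * Complex.I)) := by
        rw [← Complex.exp_add, ← Complex.exp_add]
        congr 1; push_cast; ring
      linear_combination (φ t * F u) * this
    simp_rw [e1, e2]
    refine integral_integral_swap (f := fun u t : ℝ => ((F u : ℂ) * Complex.exp (-(σ * u : ℝ))) * φ t *
          Complex.exp (-(t * (u - y) * Complex.I))) ?_
    refine ((hFi σ hσ).mul_prod hφi).mul_bdd (c := 1) ?_ ?_
    · exact Continuous.aestronglyMeasurable (by fun_prop)
    · refine Eventually.of_forall fun p => ?_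
      have : -((p.2 : ℂ) * (p.1 - y) * Complex.I) = ((-(p.2 * (p.1 - y)) : ℝ) : ℂ) * Complex.I := by
        push_cast; ring
      rw [this, Complex.norm_exp_ofReal_mul_I]
  simp_rw [key]
  have hRL := Real.tendsto_integral_exp_smul_cocompact (fun t : ℝ => φ t * G 0 t)
  have hw : Tendsto (fun y : ℝ => -(y / (2 * π))) atTop (cocompact ℝ) := by
    refine Tendsto.mono_right ?_ atBot_le_cocompact
    exact tendsto_neg_atTop_atBot.comp (tendsto_id.atTop_div_const (by positivity))
  refine (hRL.comp hw).congr fun y => ?_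
  simp only [Function.comp]
  congr 1; ext t
  rw [Circle.smul_def, Real.fourierChar_apply, smul_eq_mul]
  have : ((2 * π * -(t * -(y / (2 * π))) : ℝ) : ℂ) = t * y := by
    rw [← Complex.ofReal_mul]; congr 1
    field_simp
  rw [this]; ring

/-- The Fejer kernel. -/
noncomputable def pgK (v : ℝ) : ℝ := Real.sinc (v / 2) ^ 2

theorem pgK_nonneg (v : ℝ) : 0 ≤ pgK v := sq_nonneg _

theorem pgK_continuous : Continuous pgK := by
  unfold pgK
  have := Real.continuous_sinc
  fun_prop

theorem pgK_bound (v : ℝ) : pgK v ≤ 5 * (1 + v ^ 2)⁻¹ := by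
  have h1 : pgK v ≤ 1 := by
    unfold pgK
    rw [sq_le_one_iff_abs_le_one]
    exact Real.abs_sinc_le_one _
  have h2 : pgK v * v ^ 2 ≤ 4 := by
    unfold pgK
    by_cases hv : v = 0
    · simp [hv]
    · rw [Real.sinc_of_ne_zero (by simpa using hv)]
      have := Real.sin_sq_le_one (v / 2)
      field_simp
      linarith
  rw [← div_eq_mul_inv, le_div_iff₀ (by positivity)]
  linarith

open MeasureTheory in
theorem pgK_integrable : Integrable pgK := by
  refine (integrable_inv_one_add_sq.const_mul 5).mono' pgK_continuous.aestronglyMeasurable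
    (Eventually.of_forall fun v => ?_)
  rw [Real.norm_eq_abs, abs_of_nonneg (pgK_nonneg v)]
  exact pgK_bound v

/-- The triangle function. -/
noncomputable def pgPhi (t : ℝ) : ℂ := ((max 0 (1 - |t|) : ℝ) : ℂ)

theorem pgPhi_continuous : Continuous pgPhi := by
  unfold pgPhi; fun_prop

theorem pgPhi_supp : HasCompactSupport pgPhi := by
  refine HasCompactSupport.intro (K := Set.Icc (-1) 1) isCompact_Icc fun t ht => ?_
  have : 1 - |t| ≤ 0 := by
    by_contra h
    exact ht (Set.mem_Icc.2 (abs_le.1 (by linarith)))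
  simp [pgPhi, max_eq_left this]

theorem pg_half (a : ℂ) (ha : a ≠ 0) :
    ∫ t in (0:ℝ)..1, (1 - (t : ℂ)) * Complex.exp (a * t) = Complex.exp a / a ^ 2 - 1 / a - 1 / a ^ 2 := by
  have h : ∀ t : ℝ, HasDerivAt (fun t : ℝ => (1 - (t : ℂ)) * Complex.exp (a * t) / a
      + Complex.exp (a * t) / a ^ 2) ((1 - (t : ℂ)) * Complex.exp (a * t)) t := by
    intro t
    have h1 : HasDerivAt (fun t : ℝ => (t : ℂ)) 1 t := Complex.ofRealCLM.hasDerivAt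
    have h2 : HasDerivAt (fun t : ℝ => Complex.exp (a * t)) (Complex.exp (a * t) * (a * 1)) t :=
      (h1.const_mul a).cexp
    have h3 := (((h1.const_sub 1).mul h2).div_const a).add (h2.div_const (a ^ 2))
    refine h3.congr_deriv ?_
    field_simp
    ring
  rw [intervalIntegral.integral_eq_sub_of_hasDerivAt (fun t _ => h t)
    (Continuous.intervalIntegrable (by fun_prop) _ _)]
  simp
  ring

open MeasureTheory in
theorem pg_fourier (v : ℝ) :
    ∫ t : ℝ, pgPhi t * Complex.exp (-(t * v * Complex.I)) = (pgK v : ℂ) := by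
  have e0 : ∫ t : ℝ, pgPhi t * Complex.exp (-(t * v * Complex.I)) =
      ∫ t in (-1:ℝ)..1, pgPhi t * Complex.exp (-(t * v * Complex.I)) := by
    rw [intervalIntegral.integral_of_le (by norm_num)]
    symm
    refine setIntegral_eq_integral_of_forall_compl_eq_zero fun t ht => ?_
    have : 1 - |t| ≤ 0 := by
      by_contra h
      have := abs_lt.1 (show |t| < 1 by linarith)
      exact ht ⟨this.1, this.2.le⟩
    simp [pgPhi, max_eq_left this]
  have hc : Continuous fun t : ℝ => pgPhi t * Complex.exp (-(t * v * Complex.I)) := by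
    have := pgPhi_continuous
    fun_prop
  rw [e0, ← intervalIntegral.integral_add_adjacent_intervals (b := 0)
    (hc.intervalIntegrable _ _) (hc.intervalIntegrable _ _)]
  have e1 : ∫ t in (0:ℝ)..1, pgPhi t * Complex.exp (-(t * v * Complex.I)) =
      ∫ t in (0:ℝ)..1, (1 - (t : ℂ)) * Complex.exp (-(v * Complex.I) * t) := by
    refine intervalIntegral.integral_congr fun t ht => ?_
    rw [Set.uIcc_of_le zero_le_one] at ht
    simp only [pgPhi]
    rw [abs_of_nonneg ht.1, max_eq_right (by linarith [ht.2])]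
    push_cast
    congr 2; ring
  have e2 : ∫ t in (-1:ℝ)..0, pgPhi t * Complex.exp (-(t * v * Complex.I)) =
      ∫ t in (0:ℝ)..1, (1 - (t : ℂ)) * Complex.exp ((v * Complex.I) * t) := by
    have := intervalIntegral.integral_comp_neg (a := 0) (b := 1)
      (fun t : ℝ => pgPhi t * Complex.exp (-(t * v * Complex.I)))
    rw [neg_zero] at this
    rw [← this]
    refine intervalIntegral.integral_congr fun t ht => ?_
    rw [Set.uIcc_of_le zero_le_one] at ht
    simp only [pgPhi]
    rw [abs_neg, abs_of_nonneg ht.1, max_eq_right (by linarith [ht.2])]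
    push_cast
    congr 2; ring
  rw [e1, e2]
  by_cases hv : v = 0
  · subst hv
    have h : ∫ t in (0:ℝ)..1, (1 - (t : ℂ)) = 1 / 2 := by
      have h' := intervalIntegral.integral_ofReal (a := 0) (b := 1) (f := fun x => 1 - x)
        (μ := volume)
      have h2 : ∫ t in (0:ℝ)..1, (1 - t) = 1 / 2 := by
        rw [intervalIntegral.integral_sub (by simp) (by simp)]
        simp
        norm_num
      rw [h2] at h'
      simpa using h'
    simp [pgK, h]
    norm_num
  · have hvc : (v : ℂ) ≠ 0 := by exact_mod_cast hv
    rw [pg_half _ (by simpa using hv), pg_half _ (by simpa using hv)]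
    unfold pgK
    rw [Real.sinc_of_ne_zero (by simpa using hv), div_pow, Real.sin_sq_eq_half_sub,
      show 2 * (v / 2) = v by ring]
    push_cast
    rw [Complex.cos]
    have hI : Complex.I ^ 2 = -1 := Complex.I_sq
    rw [neg_sq, mul_pow, hI]
    field_simp
    ring

open MeasureTheory Topology in
theorem pg_tauberian (k : ℝ → ℝ) (hk0 : ∀ v, 0 ≤ k v) (hki : Integrable k) (hc : 0 < ∫ w, k w)
    (f : ℝ → ℝ) (C : ℝ) (hfm : Measurable f) (hf0 : ∀ u, 0 ≤ f u) (hfC : ∀ u, f u ≤ C)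
    (hmono : ∀ u v, u ≤ v → f u * Real.exp u ≤ f v * Real.exp v)
    (hI : ∀ T > 0, Tendsto (fun y : ℝ => ∫ w, f (y + w / T) * k w) atTop (𝓝 (∫ w, k w))) :
    Tendsto f atTop (𝓝 1) := by
  set c := ∫ w, k w with hcdef
  let cA : ℝ → ℝ := fun A => ∫ w in (-A)..A, k w
  have hcA : Tendsto cA atTop (𝓝 c) :=
    intervalIntegral_tendsto_integral hki tendsto_neg_atTop_atBot tendsto_id
  have hexp : Tendsto (fun A : ℝ => Real.exp (2 / A)) atTop (𝓝 1) := by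
    have h1 : Tendsto (fun A : ℝ => 2 / A) atTop (𝓝 0) := tendsto_const_nhds.div_atTop tendsto_id
    have h2 := (Real.continuous_exp.tendsto 0).comp h1
    rw [Real.exp_zero] at h2
    exact h2
  have hfk : ∀ y T : ℝ, Integrable (fun w => f (y + w / T) * k w) := by
    intro y T
    refine hki.bdd_mul (c := C) ?_ (Eventually.of_forall fun w => ?_)
    · exact Measurable.aestronglyMeasurable (by fun_prop)
    · rw [Real.norm_eq_abs, abs_of_nonneg (hf0 _)]; exact hfC _
  have hstep : ∀ u v d : ℝ, u ≤ v → v - u ≤ d → f u ≤ f v * Real.exp d := by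
    intro u v d huv hd
    have h1 := hmono u v huv
    have h2 : f u * Real.exp u ≤ (f v * Real.exp d) * Real.exp u := by
      refine h1.trans ?_
      rw [mul_assoc, ← Real.exp_add]
      have := hf0 v
      gcongr
      linarith
    exact le_of_mul_le_mul_right h2 (Real.exp_pos u)
  have hset : ∀ A > 0, cA A = ∫ w in Set.Ioc (-A) A, k w := fun A hA =>
    intervalIntegral.integral_of_le (by linarith)
  have hdiv : ∀ A : ℝ, A > 0 → ∀ w ∈ Set.Ioc (-A) A, |w / A ^ 2| ≤ 1 / A := by
    intro A hA w hw
    rw [abs_div, abs_of_pos (by positivity : 0 < A ^ 2), div_le_div_iff₀ (by positivity) hA]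
    have : |w| ≤ A := abs_le.2 ⟨hw.1.le, hw.2⟩
    nlinarith
  -- upper inequality
  have hup : ∀ A > 0, ∀ y, f y * cA A ≤ Real.exp (2 / A) * ∫ w, f ((y + 1 / A) + w / A ^ 2) * k w := by
    intro A hA y
    rw [hset A hA, ← integral_const_mul, ← integral_const_mul]
    refine le_trans ?_ (setIntegral_le_integral (s := Set.Ioc (-A) A) ((hfk _ _).const_mul _)
      (Eventually.of_forall fun w => ?_))
    · refine setIntegral_mono_on (hki.integrableOn.const_mul _)
        ((hfk _ _).const_mul _).integrableOn measurableSet_Ioc fun w hw => ?_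
      have h := abs_le.1 (hdiv A hA w hw)
      have h2 : (2:ℝ) / A = 1 / A + 1 / A := by ring
      have := hstep y ((y + 1 / A) + w / A ^ 2) (2 / A) (by linarith) (by linarith)
      calc f y * k w ≤ (f ((y + 1 / A) + w / A ^ 2) * Real.exp (2 / A)) * k w := by
            have := hk0 w
            gcongr
        _ = _ := by ring
    · have := hk0 w
      have := hf0 (y + 1 / A + w / A ^ 2)
      positivity
  -- lower inequality
  have hlow : ∀ A > 0, ∀ y, ∫ w, f ((y - 1 / A) + w / A ^ 2) * k w ≤
      f y * (Real.exp (2 / A) * cA A) + C * (c - cA A) := by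
    intro A hA y
    rw [← integral_add_compl (measurableSet_Ioc (a := -A) (b := A)) (hfk _ _)]
    have hcc : c - cA A = ∫ w in (Set.Ioc (-A) A)ᶜ, k w := by
      rw [hset A hA, hcdef, ← integral_add_compl (measurableSet_Ioc (a := -A) (b := A)) hki]
      ring
    rw [hcc, hset A hA, ← mul_assoc, ← integral_const_mul, ← integral_const_mul]
    refine add_le_add ?_ ?_
    · refine setIntegral_mono_on (hfk _ _).integrableOn
        (hki.integrableOn.const_mul _) measurableSet_Ioc fun w hw => ?_
      have h := abs_le.1 (hdiv A hA w hw)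
      have h2 : (2:ℝ) / A = 1 / A + 1 / A := by ring
      have := hstep ((y - 1 / A) + w / A ^ 2) y (2 / A) (by linarith) (by linarith)
      have := hk0 w
      gcongr
    · refine setIntegral_mono_on (hfk _ _).integrableOn
        (hki.integrableOn.const_mul _) measurableSet_Ioc.compl fun w hw => ?_
      have := hk0 w
      gcongr
      exact hfC _
  rw [tendsto_order]
  constructor
  · intro b hb
    have hlim : Tendsto (fun A => (c - C * (c - cA A)) / (Real.exp (2 / A) * cA A)) atTop
        (𝓝 ((c - C * (c - c)) / (1 * c))) :=
      (tendsto_const_nhds.sub ((tendsto_const_nhds.sub hcA).const_mul C)).div (hexp.mul hcA)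
        (by simpa using hc.ne')
    have hone : (c - C * (c - c)) / (1 * c) = 1 := by
      rw [sub_self, mul_zero, sub_zero, one_mul, div_self hc.ne']
    rw [hone] at hlim
    obtain ⟨A, hA1, hA2, hA3⟩ := ((hlim.eventually (lt_mem_nhds hb)).and
      ((hcA.eventually (lt_mem_nhds hc)).and (eventually_gt_atTop 0))).exists
    have hpos : 0 < Real.exp (2 / A) * cA A := by positivity
    have h1 : b * (Real.exp (2 / A) * cA A) + C * (c - cA A) < c := by
      rw [lt_div_iff₀ hpos] at hA1
      linarith
    have h2 := (hI (A ^ 2) (by positivity)).comp (tendsto_atTop_add_const_right atTop (-(1 / A)) tendsto_id)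
    filter_upwards [h2.eventually (lt_mem_nhds h1)] with y hy
    have h3 := hlow A hA3 y
    simp only [Function.comp, id, ← sub_eq_add_neg] at hy
    have h4 : b * (Real.exp (2 / A) * cA A) < f y * (Real.exp (2 / A) * cA A) := by linarith
    exact lt_of_mul_lt_mul_right h4 hpos.le
  · intro b hb
    have hlim : Tendsto (fun A => Real.exp (2 / A) * c / cA A) atTop (𝓝 (1 * c / c)) :=
      (hexp.mul_const c).div hcA hc.ne'
    have hone : 1 * c / c = 1 := by rw [one_mul, div_self hc.ne']
    rw [hone] at hlim
    obtain ⟨A, hA1, hA2, hA3⟩ := ((hlim.eventually (gt_mem_nhds hb)).and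
      ((hcA.eventually (lt_mem_nhds hc)).and (eventually_gt_atTop 0))).exists
    rw [div_lt_iff₀ hA2] at hA1
    have h2 := ((hI (A ^ 2) (by positivity)).comp
      (tendsto_atTop_add_const_right atTop (1 / A) tendsto_id)).const_mul (Real.exp (2 / A))
    filter_upwards [h2.eventually (gt_mem_nhds hA1)] with y hy
    have h3 := hup A hA3 y
    simp only [Function.comp, id] at hy
    exact lt_of_mul_lt_mul_right (h3.trans_lt hy) hA2.le

theorem pg_H : ∃ H : ℂ → ℂ, ContinuousOn H {s | 1 ≤ s.re} ∧ ∀ s : ℂ, 1 < s.re →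
    LSeries (fun n => ((ArithmeticFunction.vonMangoldt n : ℝ) : ℂ)) s = H s + 1 / (s - 1) := by
  refine ⟨ArithmeticFunction.vonMangoldt.LFunctionResidueClassAux (q := 1) 1,
    ArithmeticFunction.vonMangoldt.continuousOn_LFunctionResidueClassAux 1, fun s hs => ?_⟩
  have h := ArithmeticFunction.vonMangoldt.eqOn_LFunctionResidueClassAux (q := 1) (a := 1)
    isUnit_one hs
  have e : (fun n => ((ArithmeticFunction.vonMangoldt.residueClass (q := 1) 1 n : ℝ) : ℂ)) =
      (fun n => ((ArithmeticFunction.vonMangoldt n : ℝ) : ℂ)) := by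
    ext n
    rw [ArithmeticFunction.vonMangoldt.residueClass, Set.indicator_of_mem]
    exact Subsingleton.elim _ _
  simp only [e] at h
  rw [h]
  simp

/-- Normalized Chebyshev function. -/
noncomputable def pgf (u : ℝ) : ℝ := Chebyshev.psi (Real.exp u) * Real.exp (-u)

theorem pgf_nonneg (u : ℝ) : 0 ≤ pgf u :=
  mul_nonneg (Chebyshev.psi_nonneg _) (Real.exp_pos _).le

theorem pgf_le (u : ℝ) : pgf u ≤ Real.log 4 + 4 := by
  unfold pgf
  have h := Chebyshev.psi_le_const_mul_self (Real.exp_pos u).le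
  calc _ ≤ ((Real.log 4 + 4) * Real.exp u) * Real.exp (-u) := by gcongr
    _ = _ := by rw [mul_assoc, ← Real.exp_add]; simp

theorem pgf_meas : Measurable pgf := by
  unfold pgf
  exact (Chebyshev.psi_mono.measurable.comp Real.measurable_exp).mul (by fun_prop)

theorem pgf_zero (u : ℝ) (hu : u ≤ 0) : pgf u = 0 := by
  unfold pgf
  rw [Chebyshev.psi_eq_zero_of_le_one (Real.exp_le_one_iff.2 hu), zero_mul]

theorem pgf_mono (u v : ℝ) (h : u ≤ v) : pgf u * Real.exp u ≤ pgf v * Real.exp v := by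
  unfold pgf
  rw [mul_assoc, mul_assoc, ← Real.exp_add, ← Real.exp_add]
  simpa using Chebyshev.psi_mono (Real.exp_le_exp.2 h)

open MeasureTheory in
theorem pg_laplace (z : ℂ) (hz : 0 < z.re) :
    ∫ u in Set.Ioi (0:ℝ), (pgf u : ℂ) * Complex.exp (-z * u) =
      LSeries (fun n => ((ArithmeticFunction.vonMangoldt n : ℝ) : ℂ)) (1 + z) / (1 + z) := by
  have h1z : (1 + z) ≠ 0 := by
    intro h
    have := congrArg Complex.re h
    simp at this
    linarith
  have hO : (fun n : ℕ => ∑ k ∈ Finset.Icc 1 n, ArithmeticFunction.vonMangoldt k) =O[atTop]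
      fun n : ℕ => (n : ℝ) ^ (1:ℝ) := by
    refine Asymptotics.IsBigO.of_bound (Real.log 4 + 4) (Eventually.of_forall fun n => ?_)
    have h := Chebyshev.psi_le_const_mul_self (x := n) (by positivity)
    have h0 := Chebyshev.psi_nonneg (n : ℝ)
    have e : ∑ k ∈ Finset.Icc 1 n, ArithmeticFunction.vonMangoldt k = Chebyshev.psi n := by
      simp [Chebyshev.psi, ← Finset.Icc_add_one_left_eq_Ioc]
    rw [e, Real.rpow_one, Real.norm_of_nonneg h0, Real.norm_of_nonneg (by positivity)]
    exact h
  rw [LSeries_eq_mul_integral_of_nonneg (fun n => ArithmeticFunction.vonMangoldt n) zero_le_one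
    (s := 1 + z) (by simpa using hz) hO (fun n => ArithmeticFunction.vonMangoldt_nonneg),
    mul_div_cancel_left₀ _ h1z]
  have := integral_comp_exp_Ioi (fun t : ℝ => (∑ k ∈ Finset.Icc 1 ⌊t⌋₊,
    ((ArithmeticFunction.vonMangoldt k : ℝ) : ℂ)) * (t : ℂ) ^ (-(1 + z + 1))) 0
  rw [Real.exp_zero] at this
  rw [← this]
  refine setIntegral_congr_fun measurableSet_Ioi fun u _ => ?_
  have e : (∑ k ∈ Finset.Icc 1 ⌊Real.exp u⌋₊, ((ArithmeticFunction.vonMangoldt k : ℝ) : ℂ)) =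
      (Chebyshev.psi (Real.exp u) : ℂ) := by
    simp [Chebyshev.psi, ← Finset.Icc_add_one_left_eq_Ioc]
  simp only [e]
  have e2 : ((Real.exp u : ℝ) : ℂ) ^ (-(1 + z + 1)) = Complex.exp (u * (-(1 + z + 1))) := by
    rw [Complex.cpow_def_of_ne_zero (by exact_mod_cast (Real.exp_pos u).ne'),
      ← Complex.ofReal_log (Real.exp_pos u).le, Real.log_exp]
  rw [e2, pgf, Complex.real_smul]
  push_cast
  have e3 : Complex.exp (-u) * Complex.exp (-z * u) =
      Complex.exp u * Complex.exp (u * (-(1 + z + 1))) := by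
    rw [← Complex.exp_add, ← Complex.exp_add]; congr 1; ring
  linear_combination (Chebyshev.psi (Real.exp u) : ℂ) * e3

/-- Centered normalized Chebyshev function. -/
noncomputable def pgF (u : ℝ) : ℝ := pgf u - (Set.Ioi (0:ℝ)).indicator 1 u

theorem pgF_meas : Measurable pgF :=
  pgf_meas.sub (measurable_one.indicator measurableSet_Ioi)

theorem pgF_zero (u : ℝ) (hu : u ≤ 0) : pgF u = 0 := by
  rw [pgF, pgf_zero u hu, Set.indicator_of_notMem (by simpa using hu), sub_zero]

theorem pgF_bound (u : ℝ) : |pgF u| ≤ Real.log 4 + 5 := by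
  have h1 := pgf_nonneg u
  have h2 := pgf_le u
  have h3 : 0 ≤ Real.log 4 := Real.log_nonneg (by norm_num)
  rw [pgF, abs_le]
  by_cases hu : 0 < u
  · rw [Set.indicator_of_mem (by exact hu)]
    simp only [Pi.one_apply]
    constructor <;> linarith
  · rw [Set.indicator_of_notMem (by simpa using hu)]
    constructor <;> linarith

open MeasureTheory in
theorem pgF_laplace (H : ℂ → ℂ) (hH : ∀ s : ℂ, 1 < s.re →
    LSeries (fun n => ((ArithmeticFunction.vonMangoldt n : ℝ) : ℂ)) s = H s + 1 / (s - 1))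
    (z : ℂ) (hz : 0 < z.re) :
    ∫ u : ℝ, (pgF u : ℂ) * Complex.exp (-z * u) = (H (1 + z) - 1) / (1 + z) := by
  have h1z : (1 + z) ≠ 0 := by
    intro h
    have := congrArg Complex.re h
    simp at this
    linarith
  have hz0 : z ≠ 0 := by
    rintro rfl
    simp at hz
  have hint : IntegrableOn (fun u : ℝ => Complex.exp (-z * u)) (Set.Ioi 0) :=
    integrableOn_exp_mul_complex_Ioi (by simpa using hz) 0
  have hint2 : IntegrableOn (fun u : ℝ => (pgf u : ℂ) * Complex.exp (-z * u)) (Set.Ioi 0) := by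
    refine hint.bdd_mul (c := Real.log 4 + 4) ?_ (Eventually.of_forall fun u => ?_)
    · have := pgf_meas
      exact Measurable.aestronglyMeasurable (by fun_prop)
    · rw [Complex.norm_real, Real.norm_of_nonneg (pgf_nonneg u)]
      exact pgf_le u
  have e1 : ∫ u : ℝ, (pgF u : ℂ) * Complex.exp (-z * u) =
      ∫ u in Set.Ioi (0:ℝ), ((pgf u : ℂ) * Complex.exp (-z * u) - Complex.exp (-z * u)) := by
    rw [← setIntegral_eq_integral_of_forall_compl_eq_zero (s := Set.Ioi (0:ℝ))]
    · refine setIntegral_congr_fun measurableSet_Ioi fun u hu => ?_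
      simp only [pgF]
      rw [Set.indicator_of_mem hu]
      simp only [Pi.one_apply]
      push_cast; ring
    · intro u hu
      rw [pgF_zero u (by simpa using hu)]
      simp
  rw [e1, integral_sub hint2 hint, pg_laplace z hz, hH _ (by simpa using hz),
    integral_exp_mul_complex_Ioi (by simpa using hz)]
  simp
  field_simp
  ring

open MeasureTheory Topology in
theorem pg_conv (T : ℝ) (hT : 0 < T) :
    Tendsto (fun y : ℝ => ∫ w, pgF (y + w / T) * pgK w) atTop (𝓝 0) := by
  obtain ⟨H, hHc, hH⟩ := pg_H
  have hs := pg_smoothing (fun u => pgF (u / T)) (Real.log 4 + 5)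
    (pgF_meas.comp (measurable_id.div_const T)) (fun u => pgF_bound _)
    (fun u hu => pgF_zero _ (div_nonpos_of_nonpos_of_nonneg hu hT.le))
    (fun σ t => T * ((H (1 + T * (σ + t * Complex.I)) - 1) / (1 + T * (σ + t * Complex.I))))
    ?_ ?_ pgPhi pgPhi_continuous pgPhi_supp (fun v => (pgK v : ℂ)) pgK_integrable.ofReal pg_fourier
  · have h2 := hs.comp (tendsto_id.const_mul_atTop hT)
    have h3 := (Complex.continuous_re.tendsto 0).comp h2
    rw [Complex.zero_re] at h3
    refine h3.congr fun y => ?_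
    simp only [Function.comp, id]
    rw [← integral_add_right_eq_self _ (T * y)]
    simp only [add_sub_cancel_right]
    have : ∀ w : ℝ, ((pgF ((w + T * y) / T) : ℝ) : ℂ) * (pgK w : ℂ) =
        ((pgF (y + w / T) * pgK w : ℝ) : ℂ) := by
      intro w
      rw [show (w + T * y) / T = y + w / T by field_simp; ring]
      push_cast; ring
    simp_rw [this]
    rw [integral_complex_ofReal, Complex.ofReal_re]
  · have hre : ∀ p : ℝ × ℝ, (1 + (T : ℂ) * (p.1 + p.2 * Complex.I)).re = 1 + T * p.1 := by
      intro p; simp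
    have hcont : Continuous fun p : ℝ × ℝ => (1 + (T : ℂ) * (p.1 + p.2 * Complex.I)) := by fun_prop
    have hmap : ∀ p ∈ {p : ℝ × ℝ | 0 ≤ p.1}, (1 + (T : ℂ) * (p.1 + p.2 * Complex.I)) ∈ {s : ℂ | 1 ≤ s.re} := by
      intro p hp
      have hp : 0 ≤ p.1 := hp
      simp only [Set.mem_ofPred_eq, hre]
      have := mul_nonneg hT.le hp
      linarith
    refine continuousOn_const.mul (((hHc.comp hcont.continuousOn hmap).sub continuousOn_const).div
      hcont.continuousOn ?_)
    intro p hp h0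
    have h1 := hmap p hp
    simp only [Set.mem_ofPred_eq, h0, Complex.zero_re] at h1
    linarith
  · intro σ hσ t
    have h := pgF_laplace H hH (T * (σ + t * Complex.I)) (by simpa using mul_pos hT hσ)
    rw [← h]
    have h2 := Measure.integral_comp_div
      (fun u : ℝ => (pgF u : ℂ) * Complex.exp (-(T * (σ + t * Complex.I)) * u)) T
    rw [abs_of_pos hT, Complex.real_smul] at h2
    rw [← h2]
    congr 1; ext u
    congr 2
    have : (T : ℂ) ≠ 0 := by exact_mod_cast hT.ne'
    push_cast
    field_simp

open MeasureTheory Topology in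
theorem pgf_tendsto : Tendsto pgf atTop (𝓝 1) := by
  have hpos : 0 < ∫ w, pgK w := by
    rw [integral_pos_iff_support_of_nonneg pgK_nonneg pgK_integrable]
    refine pgK_continuous.isOpen_support.measure_pos _ ⟨0, ?_⟩
    simp [pgK]
  refine pg_tauberian pgK pgK_nonneg pgK_integrable hpos pgf _ pgf_meas pgf_nonneg pgf_le pgf_mono ?_
  intro T hT
  have hI : Tendsto (fun y : ℝ => ∫ w, (Set.Ioi (0:ℝ)).indicator 1 (y + w / T) * pgK w) atTop
      (𝓝 (∫ w, pgK w)) := by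
    refine tendsto_integral_filter_of_dominated_convergence pgK ?_ ?_ pgK_integrable ?_
    · refine Eventually.of_forall fun y => Measurable.aestronglyMeasurable ?_
      have h1 : Measurable ((Set.Ioi (0:ℝ)).indicator (1 : ℝ → ℝ)) :=
        measurable_one.indicator measurableSet_Ioi
      exact (h1.comp (by fun_prop)).mul pgK_continuous.measurable
    · refine Eventually.of_forall fun y => Eventually.of_forall fun w => ?_
      rw [norm_mul, Real.norm_of_nonneg (pgK_nonneg w)]
      refine mul_le_of_le_one_left (pgK_nonneg w) ?_
      refine (norm_indicator_le_norm_self _ _).trans ?_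
      simp
    · refine Eventually.of_forall fun w => ?_
      refine tendsto_const_nhds.congr' ?_
      filter_upwards [eventually_gt_atTop (-(w / T))] with y hy
      rw [Set.indicator_of_mem (by simp only [Set.mem_Ioi]; linarith)]
      simp
  have := (pg_conv T hT).add hI
  rw [zero_add] at this
  refine this.congr fun y => ?_
  have hm : Measurable fun w : ℝ => y + w / T := by fun_prop
  have h1 : Measurable ((Set.Ioi (0:ℝ)).indicator (1 : ℝ → ℝ)) :=
    measurable_one.indicator measurableSet_Ioi
  rw [← integral_add]
  · congr 1; ext w
    rw [pgF]; ring
  · exact pgK_integrable.bdd_mul (c := Real.log 4 + 5) (pgF_meas.comp hm).aestronglyMeasurable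
      (Eventually.of_forall fun w => pgF_bound _)
  · refine pgK_integrable.bdd_mul (c := 1) (h1.comp hm).aestronglyMeasurable
      (Eventually.of_forall fun w => ?_)
    refine (norm_indicator_le_norm_self _ _).trans ?_
    simp

open Topology in
theorem pg_psi : Tendsto (fun x : ℝ => Chebyshev.psi x / x) atTop (𝓝 1) := by
  refine (pgf_tendsto.comp Real.tendsto_log_atTop).congr' ?_
  filter_upwards [eventually_gt_atTop 0] with x hx
  simp only [Function.comp, pgf]
  rw [Real.exp_neg, Real.exp_log hx, div_eq_mul_inv]

open Topology in
theorem pg_pnt : Tendsto (fun x : ℝ => (x / Real.log x) / (Nat.primeCounting ⌊x⌋₊ : ℝ)) atTop (𝓝 1) := by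
  have h1 : Tendsto (fun x : ℝ => (Chebyshev.psi x - Chebyshev.theta x) / x) atTop (𝓝 0) := by
    have := Chebyshev.isBigO_psi_sub_theta_sqrt.trans_isLittleO (k := fun x : ℝ => x) ?_
    · exact this.tendsto_div_nhds_zero
    · rw [Asymptotics.isLittleO_iff]
      intro c hc
      filter_upwards [Real.tendsto_sqrt_atTop.eventually_ge_atTop (1/c), eventually_ge_atTop (0:ℝ)] with x hx hx0
      rw [Real.norm_of_nonneg (Real.sqrt_nonneg x), Real.norm_of_nonneg hx0]
      have h1 : 1 ≤ c * Real.sqrt x := by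
        rw [div_le_iff₀ hc] at hx
        linarith
      calc Real.sqrt x = 1 * Real.sqrt x := by ring
        _ ≤ (c * Real.sqrt x) * Real.sqrt x := by
          exact mul_le_mul_of_nonneg_right h1 (Real.sqrt_nonneg x)
        _ = c * x := by rw [mul_assoc, Real.mul_self_sqrt hx0]
  have h2 : Tendsto (fun x : ℝ => Chebyshev.theta x / x) atTop (𝓝 1) := by
    have := pg_psi.sub h1
    rw [sub_zero] at this
    refine this.congr fun x => ?_
    ring
  have h3 := Chebyshev.integral_theta_div_log_sq_isLittleO.tendsto_div_nhds_zero
  have h4 : Tendsto (fun x : ℝ => (Nat.primeCounting ⌊x⌋₊ : ℝ) / (x / Real.log x)) atTop (𝓝 1) := by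
    have := h2.add h3
    rw [add_zero] at this
    refine this.congr' ?_
    filter_upwards [eventually_ge_atTop 2] with x hx
    rw [Chebyshev.primeCounting_eq_theta_div_log_add_integral hx]
    have : 0 < Real.log x := Real.log_pos (by linarith)
    field_simp
  have h5 := h4.inv₀ one_ne_zero
  rw [inv_one] at h5
  refine h5.congr fun x => ?_
  rw [inv_div]

open Topology in
theorem pg_nth : Tendsto (fun n : ℕ => ((Nat.nth Nat.Prime n : ℝ) / Real.log (Nat.nth Nat.Prime n)) / n)
    atTop (𝓝 1) := by
  have hP : Tendsto (fun n : ℕ => ((Nat.nth Nat.Prime n : ℕ) : ℝ)) atTop atTop :=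
    tendsto_natCast_atTop_atTop.comp (Nat.nth_strictMono Nat.infinite_setOfPred_prime).tendsto_atTop
  have h1 := pg_pnt.comp hP
  have h2 : Tendsto (fun n : ℕ => ((n : ℝ) + 1) / n) atTop (𝓝 1) := by
    have := tendsto_one_div_atTop_nhds_zero_nat (𝕜 := ℝ)
    have h := this.const_add 1
    rw [add_zero] at h
    refine h.congr' ?_
    filter_upwards [eventually_gt_atTop 0] with n hn
    field_simp
  have h3 := h1.mul h2
  rw [one_mul] at h3
  refine h3.congr fun n => ?_
  simp only [Function.comp, Nat.floor_natCast]
  have : Nat.primeCounting (Nat.nth Nat.Prime n) = n + 1 := by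
    rw [Nat.primeCounting, Nat.primeCounting']
    exact Nat.count_nth_succ_of_infinite Nat.infinite_setOfPred_prime n
  rw [this]
  push_cast
  have : (n : ℝ) + 1 ≠ 0 := by positivity
  field_simp

open Topology Asymptotics in
theorem pg_avg : Tendsto (fun N : ℕ => (∑ i ∈ Finset.range N,
    ((Nat.nth Nat.Prime (i + 1) : ℝ) - Nat.nth Nat.Prime i) / Real.log (Nat.nth Nat.Prime i)) / N)
    atTop (𝓝 1) := by
  set P : ℕ → ℝ := fun n => ((Nat.nth Nat.Prime n : ℕ) : ℝ) with hPdef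
  have hP2 : ∀ n, 2 ≤ P n := fun n => by
    have := (Nat.prime_nth_prime n).two_le
    simp only [hPdef]; exact_mod_cast this
  have hPlt : ∀ n, P n < P (n + 1) := fun n => by
    have := Nat.nth_strictMono Nat.infinite_setOfPred_prime (Nat.lt_succ_self n)
    simp only [hPdef]; exact_mod_cast this
  have hPle : ∀ n, P (n + 1) ≤ 2 * P n := fun n => by
    obtain ⟨p, hp, hlt, hle⟩ := Nat.exists_prime_lt_and_le_two_mul (Nat.nth Nat.Prime n)
      (Nat.prime_nth_prime n).ne_zero
    have : Nat.nth Nat.Prime (n + 1) ≤ p := by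
      by_contra h
      exact absurd hp (fun hp => by
        have := Nat.lt_nth_iff_count_lt Nat.infinite_setOfPred_prime (a := n + 1) (b := p)
        have h1 := Nat.count_monotone Nat.Prime (Nat.succ_le_of_lt hlt)
        have h2 := Nat.count_nth_succ_of_infinite Nat.infinite_setOfPred_prime n
        have h3 := Nat.nth_count hp
        have h4 : n + 1 ≤ Nat.count Nat.Prime p := by
          simpa [h2] using h1
        have h5 := (Nat.nth_strictMono Nat.infinite_setOfPred_prime).monotone h4
        rw [h3] at h5
        exact h h5)
    simp only [hPdef]; exact_mod_cast this.trans hle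
  have hL : ∀ n, 0 < Real.log (P n) := fun n => Real.log_pos (by linarith [hP2 n])
  have hPtop : Tendsto P atTop atTop :=
    tendsto_natCast_atTop_atTop.comp (Nat.nth_strictMono Nat.infinite_setOfPred_prime).tendsto_atTop
  let a : ℕ → ℝ := fun n => P n / Real.log (P n)
  let s : ℕ → ℝ := fun i => (P (i + 1) - P i) / Real.log (P i)
  have ha : Tendsto (fun n : ℕ => a n / n) atTop (𝓝 1) := pg_nth
  let A : ℕ → ℝ := fun N => a N - a 0
  let S : ℕ → ℝ := fun N => ∑ i ∈ Finset.range N, s i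
  have hA : A ~[atTop] (fun n : ℕ => (n : ℝ)) := by
    rw [isEquivalent_iff_tendsto_one]
    · have h0 : Tendsto (fun n : ℕ => a 0 / (n : ℝ)) atTop (𝓝 0) :=
        tendsto_const_nhds.div_atTop tendsto_natCast_atTop_atTop
      have := ha.sub h0
      rw [sub_zero] at this
      refine this.congr fun n => ?_
      simp only [A, Pi.div_apply]; ring
    · filter_upwards [eventually_gt_atTop 0] with n hn
      positivity
  have hAtop : Tendsto A atTop atTop := hA.symm.tendsto_atTop tendsto_natCast_atTop_atTop
  let e : ℕ → ℝ := fun i => s i - (a (i + 1) - a i)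
  have hs0 : ∀ i, 0 ≤ s i := fun i => div_nonneg (by linarith [hPlt i]) (hL i).le
  have hee : ∀ i, e i = P (i + 1) * (Real.log (P (i + 1)) - Real.log (P i)) /
      (Real.log (P i) * Real.log (P (i + 1))) := by
    intro i
    have h1 := hL i
    have h2 := hL (i + 1)
    simp only [e, s, a]
    field_simp
    ring
  have hlog : ∀ i, 0 ≤ Real.log (P (i + 1)) - Real.log (P i) := fun i =>
    sub_nonneg.2 (Real.log_le_log (by linarith [hP2 i]) (hPlt i).le)
  have he0 : ∀ i, 0 ≤ e i := by
    intro i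
    rw [hee]
    have h1 := hL i
    have h2 := hL (i + 1)
    have h3 := hlog i
    have h4 := hP2 (i + 1)
    positivity
  have he1 : ∀ i, e i ≤ (2 / Real.log (P i)) * s i := by
    intro i
    rw [hee]
    have h1 := hL i
    have h2 := hL (i + 1)
    have h3 := hlog i
    have h4 := hP2 (i + 1)
    have h5 := hP2 i
    have h6 : Real.log (P (i + 1)) - Real.log (P i) ≤ (P (i + 1) - P i) / P i := by
      rw [← Real.log_div (by linarith) (by linarith)]
      refine (Real.log_le_sub_one_of_pos (by positivity)).trans (le_of_eq ?_)
      field_simp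
    have h7 : P (i + 1) * (Real.log (P (i + 1)) - Real.log (P i)) ≤ 2 * (P (i + 1) - P i) := by
      calc _ ≤ (2 * P i) * ((P (i + 1) - P i) / P i) := by
            have := hPle i
            gcongr
        _ = _ := by field_simp
    calc _ ≤ 2 * (P (i + 1) - P i) / (Real.log (P i) * Real.log (P i)) := by
          have := hPlt i
          have h8 : Real.log (P i) ≤ Real.log (P (i + 1)) := by linarith
          have h9 : 0 ≤ P (i + 1) - P i := by linarith
          gcongr
      _ = _ := by simp only [s]; field_simp
  have hsumE : ∀ N, ∑ i ∈ Finset.range N, e i = S N - A N := by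
    intro N
    simp only [e, S, A]
    rw [Finset.sum_sub_distrib, Finset.sum_range_sub]
  have hStop : Tendsto S atTop atTop := by
    refine tendsto_atTop_mono (fun N => ?_) hAtop
    have := hsumE N
    have h := Finset.sum_nonneg (fun i (_ : i ∈ Finset.range N) => he0 i)
    linarith
  have heo : e =o[atTop] s := by
    refine IsLittleO.of_bound fun c hc => ?_
    have h1 : Tendsto (fun i => 2 / Real.log (P i)) atTop (𝓝 0) :=
      tendsto_const_nhds.div_atTop (Real.tendsto_log_atTop.comp hPtop)
    filter_upwards [h1.eventually (gt_mem_nhds hc)] with i hi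
    rw [Real.norm_of_nonneg (he0 i), Real.norm_of_nonneg (hs0 i)]
    exact (he1 i).trans (mul_le_mul_of_nonneg_right hi.le (hs0 i))
  have hEo := heo.sum_range hs0 hStop
  have hSA : A ~[atTop] S := by
    have : (A - S) =o[atTop] S := by
      refine hEo.neg_left.congr_left fun N => ?_
      rw [hsumE N]
      simp
    exact this
  have hS : S ~[atTop] (fun n : ℕ => (n : ℝ)) := hSA.symm.trans hA
  rw [isEquivalent_iff_tendsto_one] at hS
  · exact hS
  · filter_upwards [eventually_gt_atTop 0] with n hn
    positivity

/-- As `x → ∞`, the average of `d_n / log p_n` over `1 ≤ n ≤ x` tends to `1`,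
where `d_n = p_{n+1} - p_n`. -/
theorem average_normalized_prime_gap_tendsto_one :
    Tendsto (fun x : ℝ => (1 / x) * ∑ n ∈ Finset.Icc 1 ⌊x⌋₊,
      ((nthPrime (n + 1) : ℝ) - nthPrime n) / Real.log (nthPrime n))
      atTop (nhds 1) := by
  have h1 := (pg_avg.comp (tendsto_nat_floor_atTop (α := ℝ))).mul (tendsto_nat_floor_div_atTop (R := ℝ))
  rw [one_mul] at h1
  refine h1.congr' ?_
  filter_upwards [eventually_ge_atTop 1] with x hx
  have hfl : 0 < ⌊x⌋₊ := Nat.floor_pos.2 hx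
  have hsum : ∑ n ∈ Finset.Icc 1 ⌊x⌋₊,
      ((nthPrime (n + 1) : ℝ) - nthPrime n) / Real.log (nthPrime n) =
      ∑ i ∈ Finset.range ⌊x⌋₊, ((Nat.nth Nat.Prime (i + 1) : ℝ) - Nat.nth Nat.Prime i) /
        Real.log (Nat.nth Nat.Prime i) := by
    symm
    refine Finset.sum_bij (fun i _ => i + 1) (fun i hi => ?_) (fun i _ j _ h => by omega) (fun n hn => ?_) (fun i _ => ?_)
    · have := Finset.mem_range.1 hi
      exact Finset.mem_Icc.2 ⟨by omega, by omega⟩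
    · have := Finset.mem_Icc.1 hn
      exact ⟨n - 1, Finset.mem_range.2 (by omega), by omega⟩
    · simp [nthPrime]
  rw [hsum]
  simp only [Function.comp]
  have : ((⌊x⌋₊ : ℕ) : ℝ) ≠ 0 := by positivity
  field_simp
end

section
/- (Erdős, 1935) There is a constant C > 0 such that for all sufficiently large X one has G(X) ≥ C · (log X · log_2 X) / (log_3 X)^2. -/
open Real Filter

/-- `iterlog k x` is the `k`-fold iterated natural logarithm `log_k x`,
with `iterlog 1 x = log x` and `iterlog (k+1) x = log (iterlog k x)`. -/
noncomputable def iterlog : ℕ → ℝ → ℝ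
  | 0, x => x
  | k + 1, x => Real.log (iterlog k x)

/-- `G X` is the maximal gap between consecutive primes `p_{n+1} ≤ X`. -/
noncomputable def G (X : ℝ) : ℝ :=
  sSup {d : ℝ | ∃ n : ℕ, 1 ≤ n ∧ (nthPrime (n + 1) : ℝ) ≤ X ∧
    d = (nthPrime (n + 1) : ℝ) - nthPrime n}

theorem gap_of_cover (n y : ℕ) (hn : 2 ≤ n) (a : ℕ → ℕ)
    (h : ∀ j, 1 ≤ j → j ≤ y → ∃ p, p.Prime ∧ p ≤ n ∧ j ≡ a p [MOD p]) :
    ∃ N, 2 ≤ N ∧ N ≤ 2 * 4 ^ n ∧ ∀ j, 1 ≤ j → j ≤ y → ¬ (N + j).Prime := by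
  classical
  set P := (Finset.range (n+1)).filter Nat.Prime with hP
  have hcop : Set.Pairwise (P : Set ℕ) (Function.onFun Nat.Coprime (fun p : ℕ => p)) := by
    intro p hp q hq hpq
    simp [hP] at hp hq
    exact (Nat.coprime_primes hp.2 hq.2).2 hpq
  have hs : ∀ i ∈ P, (fun p : ℕ => p) i ≠ 0 := by
    intro p hp
    simp [hP] at hp
    exact hp.2.ne_zero
  let k := Nat.chineseRemainderOfFinset (fun p => (p - 1) * a p) (fun p => p) P hs hcop
  have hk := k.2
  have hlt : (k : ℕ) < ∏ p ∈ P, p :=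
    Nat.chineseRemainderOfFinset_lt_prod (fun p => (p - 1) * a p) (fun p => p) hs hcop
  have hprim : ∏ p ∈ P, p = primorial n := rfl
  have h4 := primorial_le_four_pow n
  have hdvd : ∀ p, p.Prime → p ≤ n → p ∣ primorial n := by
    intro p hp hpn
    rw [← hprim]
    exact Finset.dvd_prod_of_mem _ (by simp [hP, hp]; omega)
  have hpos : 0 < primorial n := primorial_pos n
  refine ⟨k + primorial n, ?_, ?_, ?_⟩
  · have := Nat.le_of_dvd hpos (hdvd 2 Nat.prime_two hn)
    omega
  · omega
  · intro j hj1 hjy hpr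
    obtain ⟨p, hp, hpn, hmod⟩ := h j hj1 hjy
    have h1 : (k : ℕ) ≡ (p - 1) * a p [MOD p] := hk p (by simp [hP, hp]; omega)
    have h2 : (k : ℕ) + primorial n + j ≡ (p - 1) * a p + 0 + a p [MOD p] := by
      apply Nat.ModEq.add _ hmod
      apply Nat.ModEq.add h1
      exact (Nat.modEq_zero_iff_dvd).2 (hdvd p hp hpn)
    have h3 : (p - 1) * a p + 0 + a p = p * a p := by
      obtain ⟨q, rfl⟩ : ∃ q, p = q + 1 := ⟨p - 1, by have := hp.pos; omega⟩
      simp; ring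
    rw [h3] at h2
    have h4 : p ∣ (k : ℕ) + primorial n + j :=
      (Nat.modEq_zero_iff_dvd).1 (h2.trans ((Nat.modEq_zero_iff_dvd).2 (dvd_mul_right _ _)))
    have h5 := (Nat.prime_dvd_prime_iff_eq hp hpr).1 h4
    have := Nat.le_of_dvd hpos (hdvd p hp hpn)
    omega

theorem greedy (S P : Finset ℕ) (hP : ∀ p ∈ P, p.Prime) :
    ∃ a : ℕ → ℕ, (((S.filter (fun j => ∀ p ∈ P, ¬ j ≡ a p [MOD p])).card : ℕ) : ℝ)
      ≤ S.card * ∏ p ∈ P, (1 - 1 / (p : ℝ)) := by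
  classical
  induction P using Finset.induction_on with
  | empty => exact ⟨fun _ => 0, by simp⟩
  | insert q P hq ih =>
    obtain ⟨a, ha⟩ := ih (fun p hp => hP p (Finset.mem_insert_of_mem hp))
    set T := S.filter (fun j => ∀ p ∈ P, ¬ j ≡ a p [MOD p]) with hT
    have hqp : q.Prime := hP q (Finset.mem_insert_self _ _)
    have hq0 : (0:ℝ) < q := by exact_mod_cast hqp.pos
    obtain ⟨r, hr, hr2⟩ : ∃ r ∈ Finset.range q,
        (T.card : ℝ) / q ≤ ((T.filter (fun j => j % q = r)).card : ℝ) := by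
      by_contra hcon
      push Not at hcon
      have h1 : T.card = ∑ r ∈ Finset.range q, (T.filter (fun j => j % q = r)).card :=
        Finset.card_eq_sum_card_fiberwise (fun j _ => by
          simpa using Nat.mod_lt j hqp.pos)
      have h2 : (T.card : ℝ) = ∑ r ∈ Finset.range q, ((T.filter (fun j => j % q = r)).card : ℝ) := by
        exact_mod_cast h1
      have h3 : ∑ r ∈ Finset.range q, ((T.filter (fun j => j % q = r)).card : ℝ)
          < ∑ r ∈ Finset.range q, (T.card : ℝ) / q :=
        Finset.sum_lt_sum_of_nonempty (by simpa using hqp.ne_zero) hcon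
      rw [← h2] at h3
      simp at h3
      rw [mul_div_cancel₀ _ hq0.ne'] at h3
      exact lt_irrefl _ h3
    refine ⟨Function.update a q r, ?_⟩
    have hrq : r < q := by simpa using hr
    have heq : S.filter (fun j => ∀ p ∈ insert q P, ¬ j ≡ Function.update a q r p [MOD p])
        = T.filter (fun j => ¬ j % q = r) := by
      ext j
      simp only [Finset.mem_filter, Finset.forall_mem_insert, Function.update_self, hT]
      have e1 : (j ≡ r [MOD q]) ↔ j % q = r := by
        unfold Nat.ModEq; rw [Nat.mod_eq_of_lt hrq]
      have e2 : (∀ x ∈ P, ¬ j ≡ Function.update a q r x [MOD x]) ↔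
          (∀ x ∈ P, ¬ j ≡ a x [MOD x]) := by
        refine forall₂_congr fun x hx => ?_
        rw [Function.update_of_ne (by rintro rfl; exact hq hx)]
      rw [e1, e2]; tauto
    rw [heq, Finset.prod_insert hq]
    have hc := Finset.card_filter_add_card_filter_not (s := T) (fun j => j % q = r)
    have hc' : ((T.filter (fun j => j % q = r)).card : ℝ)
      + ((T.filter (fun j => ¬ j % q = r)).card : ℝ) = T.card := by exact_mod_cast hc
    have h1q : 0 ≤ 1 - 1 / (q:ℝ) := by
      rw [sub_nonneg, div_le_one hq0]; exact_mod_cast hqp.one_le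
    calc ((T.filter (fun j => ¬ j % q = r)).card : ℝ) ≤ (1 - 1/(q:ℝ)) * T.card := by
          have : (1 - 1/(q:ℝ)) * T.card = T.card - T.card / q := by ring
          linarith
      _ ≤ (1 - 1/(q:ℝ)) * (S.card * ∏ p ∈ P, (1 - 1 / (p : ℝ))) := by gcongr
      _ = _ := by ring

theorem matching (T Q : Finset ℕ) (h : T.card ≤ Q.card) :
    ∃ a : ℕ → ℕ, ∀ j ∈ T, ∃ p ∈ Q, a p = j := by
  classical
  obtain ⟨Q', hQ', hc⟩ := Finset.exists_subset_card_eq h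
  let e := Finset.equivOfCardEq hc
  refine ⟨fun p => if hp : p ∈ Q' then (e ⟨p, hp⟩ : ℕ) else 0, fun j hj => ?_⟩
  refine ⟨e.symm ⟨j, hj⟩, hQ' (e.symm ⟨j, hj⟩).2, ?_⟩
  simp

open Classical in
/-- the covering lemma -/
theorem cover (n y z w : ℕ) (hzw : z ≤ w + 1) (hwn : w ≤ n)
    (h : (((Finset.Icc 1 y).filter (fun j => ∀ p, p.Prime → z ≤ p → p ≤ w → ¬ p ∣ j)).card : ℝ)
      * ∏ p ∈ Nat.primesBelow z, (1 - 1 / (p : ℝ)) ≤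
      (((Finset.Ioc w n).filter Nat.Prime).card : ℝ)) :
    ∃ a : ℕ → ℕ, ∀ j, 1 ≤ j → j ≤ y → ∃ p, p.Prime ∧ p ≤ n ∧ j ≡ a p [MOD p] := by
  set S := (Finset.Icc 1 y).filter (fun j => ∀ p, p.Prime → z ≤ p → p ≤ w → ¬ p ∣ j) with hS
  obtain ⟨a, ha⟩ := greedy S (Nat.primesBelow z) (fun p hp => Nat.prime_of_mem_primesBelow hp)
  set T := S.filter (fun j => ∀ p ∈ Nat.primesBelow z, ¬ j ≡ a p [MOD p]) with hT
  obtain ⟨b, hb⟩ := matching T ((Finset.Ioc w n).filter Nat.Prime)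
    (by exact_mod_cast ha.trans h)
  refine ⟨fun p => if p < z then a p else if p ≤ w then 0 else b p, fun j h1 h2 => ?_⟩
  by_cases hjS : j ∈ S
  · by_cases hjT : j ∈ T
    · obtain ⟨p, hp, hpj⟩ := hb j hjT
      simp at hp
      refine ⟨p, hp.2, hp.1.2, ?_⟩
      dsimp only
      rw [if_neg (by omega), if_neg (by omega), hpj]
    · simp only [hT, Finset.mem_filter, hjS, true_and] at hjT
      push Not at hjT
      obtain ⟨p, hp, hpj⟩ := hjT
      have hpz := Nat.lt_of_mem_primesBelow hp
      refine ⟨p, Nat.prime_of_mem_primesBelow hp, by omega, ?_⟩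
      dsimp only
      rwa [if_pos hpz]
  · simp only [hS, Finset.mem_filter, Finset.mem_Icc, h1, h2, true_and] at hjS
    push Not at hjS
    obtain ⟨p, hp, hz, hw, hd⟩ := hjS
    refine ⟨p, hp, by omega, ?_⟩
    dsimp only
    rw [if_neg (by omega), if_pos hw]
    exact (Nat.modEq_zero_iff_dvd).2 hd

theorem G_ge (X : ℝ) (N y : ℕ) (hN : 2 ≤ N) (hX : ((2 * N : ℕ) : ℝ) ≤ X)
    (h : ∀ j, 1 ≤ j → j ≤ y → ¬ (N + j).Prime) : (y : ℝ) ≤ G X := by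
  set k := Nat.count Nat.Prime (N + 1) with hk
  have hk1 : 1 ≤ k := by
    have : Nat.count Nat.Prime 3 ≤ k := Nat.count_monotone _ (by omega)
    have h3 : Nat.count Nat.Prime 3 = 1 := by decide
    omega
  have hA : N + 1 ≤ Nat.nth Nat.Prime k := by
    by_contra hc
    push Not at hc
    have := Nat.count_strict_mono (p := Nat.Prime) (Nat.prime_nth_prime k) hc
    rw [Nat.count_nth_of_infinite Nat.infinite_setOfPred_prime] at this
    omega
  have hB : N + y < Nat.nth Nat.Prime k := by
    by_contra hc
    push Not at hc
    refine h (Nat.nth Nat.Prime k - N) (by omega) (by omega) ?_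
    rw [Nat.add_sub_cancel' (by omega)]
    exact Nat.prime_nth_prime k
  have hC : Nat.nth Nat.Prime (k - 1) < N + 1 :=
    Nat.nth_lt_of_lt_count (by omega)
  have hD : Nat.nth Nat.Prime k ≤ 2 * N := by
    obtain ⟨p, hp, h1, h2⟩ := Nat.exists_prime_lt_and_le_two_mul N (by omega)
    have : k ≤ Nat.count Nat.Prime p := Nat.count_monotone _ (by omega)
    have h4 : Nat.nth Nat.Prime k ≤ Nat.nth Nat.Prime (Nat.count Nat.Prime p) :=
      (Nat.nth_monotone Nat.infinite_setOfPred_prime) this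
    rw [Nat.nth_count hp] at h4
    omega
  have hmem : (nthPrime (k+1) : ℝ) - nthPrime k ∈ {d : ℝ | ∃ n : ℕ, 1 ≤ n ∧
      (nthPrime (n + 1) : ℝ) ≤ X ∧ d = (nthPrime (n + 1) : ℝ) - nthPrime n} := by
    refine ⟨k, hk1, ?_, rfl⟩
    refine le_trans ?_ hX
    exact_mod_cast hD
  have hbdd : BddAbove {d : ℝ | ∃ n : ℕ, 1 ≤ n ∧
      (nthPrime (n + 1) : ℝ) ≤ X ∧ d = (nthPrime (n + 1) : ℝ) - nthPrime n} := by
    refine ⟨X, ?_⟩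
    rintro d ⟨n, -, h1, rfl⟩
    have : (0:ℝ) ≤ nthPrime n := Nat.cast_nonneg _
    linarith
  refine le_trans ?_ (le_csSup hbdd hmem)
  have h1 : nthPrime k + y ≤ nthPrime (k+1) := by
    simp only [nthPrime, Nat.add_sub_cancel]; omega
  have : (nthPrime k : ℝ) + y ≤ nthPrime (k+1) := by exact_mod_cast h1
  linarith


theorem sum_inv_primes_step (k : ℕ) (hk : 1 ≤ k) :
    ∑ p ∈ Nat.primesBelow (2 ^ (k+1)), (1 / (p:ℝ)) ≤
      ∑ p ∈ Nat.primesBelow (2 ^ k), (1 / (p:ℝ)) + 4 * (k:ℝ)⁻¹ := by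
  have hsub : Nat.primesBelow (2 ^ k) ⊆ Nat.primesBelow (2 ^ (k+1)) := by
    intro p hp
    rw [Nat.mem_primesBelow] at hp ⊢
    exact ⟨hp.1.trans (Nat.pow_lt_pow_right (by norm_num) (by omega)), hp.2⟩
  rw [← Finset.sum_sdiff hsub, add_comm]
  gcongr
  have hk0 : (0:ℝ) < k := by exact_mod_cast hk
  have hl2 : 0 < log 2 := log_pos (by norm_num)
  have h1 : ∀ p ∈ Nat.primesBelow (2 ^ (k+1)) \ Nat.primesBelow (2 ^ k),
      (1 / (p:ℝ)) ≤ log p * (1 / (2 ^ k * (k * log 2))) := by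
    intro p hp
    rw [Finset.mem_sdiff, Nat.mem_primesBelow, Nat.mem_primesBelow] at hp
    have hge : 2 ^ k ≤ p := by
      by_contra hc
      exact hp.2 ⟨by omega, hp.1.2⟩
    have hge' : (2:ℝ) ^ k ≤ p := by exact_mod_cast hge
    have hlog : k * log 2 ≤ log p := by
      rw [← Real.log_pow]; exact Real.log_le_log (by positivity) hge'
    have hp0 : (0:ℝ) < p := lt_of_lt_of_le (by positivity) hge'
    rw [mul_one_div, div_le_div_iff₀ hp0 (by positivity), one_mul, mul_comm (log (p:ℝ))]
    gcongr
  refine (Finset.sum_le_sum h1).trans ?_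
  rw [← Finset.sum_mul]
  have h2 : ∑ p ∈ Nat.primesBelow (2 ^ (k+1)) \ Nat.primesBelow (2 ^ k), log (p:ℝ) ≤
      log 4 * (2 ^ (k+1)) := by
    have := Chebyshev.theta_le_log4_mul_x (x := ((2 ^ (k+1) : ℕ) : ℝ)) (by positivity)
    rw [Chebyshev.theta_eq_sum_primesLE_log] at this
    push_cast at this
    refine le_trans ?_ this
    apply Finset.sum_le_sum_of_subset_of_nonneg
    · intro p hp
      rw [Finset.mem_sdiff, Nat.mem_primesBelow] at hp
      rw [Nat.mem_primesLE]
      exact ⟨hp.1.1.le, hp.1.2⟩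
    · intros; exact Real.log_natCast_nonneg _
  have h4 : log 4 = 2 * log 2 := by
    rw [show (4:ℝ) = 2 ^ 2 by norm_num, Real.log_pow]; norm_num
  calc _ ≤ (log 4 * (2 ^ (k+1))) * (1 / (2 ^ k * (k * log 2))) := by gcongr
    _ = 4 * (k:ℝ)⁻¹ := by rw [h4, pow_succ]; field_simp; norm_num

theorem sum_inv_primes (K : ℕ) (hK : 1 ≤ K) :
    ∑ p ∈ Nat.primesBelow (2 ^ K), (1 / (p:ℝ)) ≤ 4 * (1 + log K) := by
  have key : ∀ K : ℕ, ∑ p ∈ Nat.primesBelow (2 ^ (K+1)), (1 / (p:ℝ)) ≤ 4 * (harmonic K : ℝ) := by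
    intro K
    induction K with
    | zero =>
      have : Nat.primesBelow (2 ^ (0+1)) = ∅ := by decide
      rw [this]; simp
    | succ K ih =>
      refine (sum_inv_primes_step (K+1) (by omega)).trans ?_
      rw [harmonic_succ]; push_cast at ih ⊢
      linarith
  rcases Nat.exists_eq_add_of_le' hK with ⟨k, rfl⟩
  have h1 := key k
  have h2 := harmonic_le_one_add_log (k+1)
  rw [harmonic_succ] at h2
  push_cast at h2 ⊢
  have : (0:ℝ) ≤ ((k:ℝ)+1)⁻¹ := by positivity
  linarith

theorem mertens_ub (z : ℕ) (hz : 2 ≤ z) :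
    ∏ p ∈ Nat.primesBelow z, (1 - 1 / (p:ℝ)) ≤ 1 / log z := by
  classical
  let f : ℕ →* ℝ := { toFun := fun m => (m:ℝ)⁻¹, map_one' := by simp,
                      map_mul' := by intro a b; push_cast; rw [mul_inv] }
  have hf : ∀ {p : ℕ}, p.Prime → ‖f p‖ < 1 := by
    intro p hp
    have : (1:ℝ) < p := by exact_mod_cast hp.one_lt
    change ‖(p:ℝ)⁻¹‖ < 1
    rw [Real.norm_of_nonneg (by positivity)]
    exact inv_lt_one_of_one_lt₀ this
  have hs := (EulerProduct.summable_and_hasSum_smoothNumbers_prod_primesBelow_geometric hf z).2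
  have hs' := (hasSum_subtype_iff_indicator (f := fun m : ℕ => f m) (s := z.smoothNumbers)).1 hs
  have h1 := sum_le_hasSum (Finset.Icc 1 (z-1)) (fun i _ =>
    Set.indicator_nonneg (fun m _ => by change (0:ℝ) ≤ (m:ℝ)⁻¹; positivity) i) hs'
  have h2 : ∑ i ∈ Finset.Icc 1 (z-1), (z.smoothNumbers).indicator (fun m : ℕ => f m) i
      = (harmonic (z-1) : ℝ) := by
    rw [harmonic_eq_sum_Icc]
    push_cast
    refine Finset.sum_congr rfl fun i hi => ?_
    rw [Finset.mem_Icc] at hi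
    rw [Set.indicator_of_mem (Nat.mem_smoothNumbers_of_lt (by omega) (by omega))]
    rfl
  rw [h2] at h1
  have h3 := log_add_one_le_harmonic (z-1)
  have h4 : ((z-1+1 : ℕ):ℝ) = z := by congr 1; omega
  push_cast at h3 h4
  rw [h4] at h3
  have h5 := h3.trans h1
  have hl : 0 < log (z:ℝ) := Real.log_pos (by exact_mod_cast (by omega : 1 < z))
  rw [Finset.prod_inv_distrib] at h5
  have h6 := inv_anti₀ hl h5
  rw [inv_inv] at h6
  rw [one_div]
  refine le_trans (le_of_eq ?_) h6
  refine Finset.prod_congr rfl fun p _ => ?_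
  rw [one_div]; rfl

open Classical in
theorem smooth_count (K y : ℕ) (hK : 3 ≤ K) (hy : 1 ≤ y) :
    (((Finset.Icc 1 y).filter (fun j => j ∈ Nat.smoothNumbers (2 ^ K))).card : ℝ) ≤
      y * exp (- (log y / (K * log 2)) + 48 * (1 + log K)) := by
  have hl2 : 0.6931 < log 2 := by have := Real.log_two_gt_d9; linarith
  have hl2' : 0 < log 2 := by linarith
  have hK' : (3:ℝ) ≤ K := by exact_mod_cast hK
  have hZ : 2 ≤ K * log 2 := by nlinarith
  set Z := K * log 2 with hZdef
  have hZ0 : 0 < Z := by linarith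
  have hZinv : 1 / Z ≤ 1 / 2 := one_div_le_one_div_of_le (by norm_num) hZ
  have hZinv0 : 0 < 1 / Z := by positivity
  set s : ℝ := -(1 - 1 / Z) with hs
  have hs1 : s ≤ -(1/2) := by rw [hs]; linarith
  have hs0 : s ≠ 0 := by linarith
  let f : ℕ →* ℝ := { toFun := fun m => (m:ℝ) ^ s, map_one' := by simp,
                      map_mul' := by
                        intro a b; push_cast
                        rw [Real.mul_rpow (by positivity) (by positivity)] }
  have hfd : ∀ m : ℕ, f m = (m:ℝ) ^ s := fun m => rfl
  have hf34 : ∀ {p : ℕ}, p.Prime → f p ≤ 3/4 := by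
    intro p hp
    have h2 : (2:ℝ) ≤ p := by exact_mod_cast hp.two_le
    calc f p = (p:ℝ) ^ s := rfl
      _ ≤ (p:ℝ) ^ (-(1/2) : ℝ) := Real.rpow_le_rpow_of_exponent_le (by linarith) hs1
      _ ≤ (2:ℝ) ^ (-(1/2) : ℝ) := Real.rpow_le_rpow_of_nonpos (by norm_num) h2 (by norm_num)
      _ = (√2)⁻¹ := by rw [Real.rpow_neg (by norm_num), Real.sqrt_eq_rpow]
      _ ≤ (4/3)⁻¹ := by
        apply inv_anti₀ (by norm_num)
        apply Real.le_sqrt_of_sq_le; norm_num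
      _ = 3/4 := by norm_num
  have hfnn : ∀ m : ℕ, 0 ≤ f m := fun m => by rw [hfd]; positivity
  have hf : ∀ {p : ℕ}, p.Prime → ‖f p‖ < 1 := by
    intro p hp
    rw [Real.norm_of_nonneg (hfnn p)]
    linarith [hf34 hp]
  have hsum := (EulerProduct.summable_and_hasSum_smoothNumbers_prod_primesBelow_geometric hf (2^K)).2
  have hsum' := (hasSum_subtype_iff_indicator (f := fun m : ℕ => f m)
    (s := (2^K).smoothNumbers)).1 hsum
  set F := (Finset.Icc 1 y).filter (fun j => j ∈ Nat.smoothNumbers (2 ^ K)) with hF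
  have h1 := sum_le_hasSum F (fun i _ =>
    Set.indicator_nonneg (fun m _ => hfnn m) i) hsum'
  have hy0 : (0:ℝ) < y := by exact_mod_cast hy
  have h2 : (F.card : ℝ) * (y:ℝ) ^ s ≤
      ∑ i ∈ F, ((2^K).smoothNumbers).indicator (fun m : ℕ => f m) i := by
    rw [← nsmul_eq_mul]
    apply Finset.card_nsmul_le_sum
    intro i hi
    rw [hF, Finset.mem_filter, Finset.mem_Icc] at hi
    rw [Set.indicator_of_mem hi.2, hfd]
    exact Real.rpow_le_rpow_of_nonpos (by exact_mod_cast hi.1.1) (by exact_mod_cast hi.1.2)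
      (by linarith)
  have h3 : ∏ p ∈ Nat.primesBelow (2^K), (1 - f p)⁻¹ ≤ exp (48 * (1 + log K)) := by
    calc ∏ p ∈ Nat.primesBelow (2^K), (1 - f p)⁻¹
        ≤ ∏ p ∈ Nat.primesBelow (2^K), exp (12 * (1 / (p:ℝ))) := by
          apply Finset.prod_le_prod
          · intro p hp
            have := hf34 (Nat.prime_of_mem_primesBelow hp)
            apply inv_nonneg.2; linarith
          · intro p hp
            have hpp := Nat.prime_of_mem_primesBelow hp
            have ht := hf34 hpp
            have ht0 := hfnn p
            have hp0 : (0:ℝ) < p := by exact_mod_cast hpp.pos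
            have hlt : (p:ℝ) ≤ 2 ^ K := by exact_mod_cast (Nat.lt_of_mem_primesBelow hp).le
            have hfp : f p ≤ 3 * (1 / (p:ℝ)) := by
              rw [hfd, hs, neg_sub, Real.rpow_sub hp0, Real.rpow_one, mul_one_div]
              gcongr
              rw [Real.rpow_def_of_pos hp0]
              have : log p * (1 / Z) ≤ 1 := by
                rw [mul_one_div, div_le_one hZ0, hZdef, ← Real.log_pow]
                exact Real.log_le_log hp0 hlt
              calc exp (log p * (1 / Z)) ≤ exp 1 := Real.exp_le_exp.2 this
                _ ≤ 3 := by have := Real.exp_one_lt_d9; linarith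
            calc (1 - f p)⁻¹ ≤ 1 + 4 * f p := by
                  rw [inv_le_iff_one_le_mul₀ (by linarith)]
                  nlinarith
              _ ≤ exp (4 * f p) := by linarith [Real.add_one_le_exp (4 * f p)]
              _ ≤ exp (12 * (1 / (p:ℝ))) := Real.exp_le_exp.2 (by linarith)
      _ = exp (12 * ∑ p ∈ Nat.primesBelow (2^K), (1 / (p:ℝ))) := by
          rw [← Real.exp_sum, Finset.mul_sum]
      _ ≤ _ := by
          apply Real.exp_le_exp.2
          have := sum_inv_primes K (by omega)
          linarith
  have h4 := (h2.trans h1).trans h3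
  have h5 : (y:ℝ) * exp (- (log y / Z) + 48 * (1 + log K)) * (y:ℝ) ^ s
     = exp (48 * (1 + log K)) := by
    rw [Real.rpow_def_of_pos hy0]
    nth_rewrite 1 [← Real.exp_log hy0]
    rw [← Real.exp_add, ← Real.exp_add, hs]
    congr 1
    ring
  have h6 : 0 < (y:ℝ) ^ s := by positivity
  rw [← h5] at h4
  exact le_of_mul_le_mul_right h4 h6

theorem large_primes : ∀ᶠ n : ℕ in atTop,
    (n:ℝ) / (8 * log n) ≤ (((Finset.Ioc (n/4) n).filter Nat.Prime).card : ℝ) := by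
  have hlog : (fun x : ℝ => log x) =o[atTop] (fun x : ℝ => x ^ (1/4:ℝ)) :=
    isLittleO_log_rpow_atTop (by norm_num)
  have e1 := (tendsto_natCast_atTop_atTop (R := ℝ)).eventually (hlog.bound (show (0:ℝ) < 1 by norm_num))
  filter_upwards [e1, eventually_ge_atTop 1000000000] with n hn1 hn
  have hn' : (1000000000:ℝ) ≤ n := by exact_mod_cast hn
  have hn0 : (0:ℝ) < n := by linarith
  have hL0 : 0 < log (n:ℝ) := Real.log_pos (by linarith)
  set r := (n:ℝ) ^ (1/4:ℝ) with hr
  have hr0 : 0 < r := by positivity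
  have hr4 : r ^ 4 = n := by
    rw [hr, ← Real.rpow_natCast, ← Real.rpow_mul hn0.le]; norm_num
  have hr100 : 100 ≤ r := by
    by_contra hc
    push Not at hc
    have : r ^ 4 < 100 ^ 4 := by gcongr
    rw [hr4] at this
    linarith
  have hLr : log n ≤ r := by
    rw [Real.norm_of_nonneg hL0.le, Real.norm_of_nonneg hr0.le] at hn1
    linarith
  have hsq : √(n:ℝ) = r ^ 2 := by
    rw [← hr4, show r ^ 4 = (r^2)^2 by ring, Real.sqrt_sq (by positivity)]
  have hθ := Chebyshev.theta_ge n
  have hθ2 := Chebyshev.theta_le_log4_mul_x (x := ((n/4 : ℕ):ℝ)) (by positivity)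
  have hdiv : ((n/4:ℕ):ℝ) ≤ n / 4 := Nat.cast_div_le
  have hl1 : log ((n:ℝ)+1) ≤ log n + 1 := by
    have : (n:ℝ) + 1 ≤ n * exp 1 := by
      nlinarith [Real.add_one_le_exp (1:ℝ)]
    calc log ((n:ℝ)+1) ≤ log (n * exp 1) := Real.log_le_log (by linarith) this
      _ = log n + 1 := by rw [Real.log_mul (by positivity) (by positivity), Real.log_exp]
  have hdiff : Chebyshev.theta n - Chebyshev.theta ((n/4:ℕ):ℝ) ≤
      (((Finset.Ioc (n/4) n).filter Nat.Prime).card : ℝ) * log n := by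
    rw [Chebyshev.theta_eq_sum_primesLE_log, Chebyshev.theta_eq_sum_primesLE_log]
    have hsub : Nat.primesLE (n/4) ⊆ Nat.primesLE n := by
      intro p hp
      rw [Nat.mem_primesLE] at hp ⊢
      exact ⟨by omega, hp.2⟩
    rw [← Finset.sum_sdiff hsub, add_sub_cancel_right, ← nsmul_eq_mul]
    have hset : Nat.primesLE n \ Nat.primesLE (n/4) = (Finset.Ioc (n/4) n).filter Nat.Prime := by
      ext p
      simp only [Finset.mem_sdiff, Nat.mem_primesLE, Finset.mem_filter, Finset.mem_Ioc]
      constructor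
      · rintro ⟨⟨h1, h2⟩, h3⟩
        exact ⟨⟨by by_contra hc; exact h3 ⟨by omega, h2⟩, h1⟩, h2⟩
      · rintro ⟨⟨h1, h2⟩, h3⟩
        exact ⟨⟨h2, h3⟩, by rintro ⟨h4, -⟩; omega⟩
    rw [hset]
    apply Finset.sum_le_card_nsmul
    intro p hp
    simp only [Finset.mem_filter, Finset.mem_Ioc] at hp
    exact Real.log_le_log (by exact_mod_cast hp.2.pos) (by exact_mod_cast hp.1.2)
  rw [← div_div, div_le_iff₀ hL0]
  refine le_trans ?_ hdiff
  have hl2 : 0.6931 < log 2 := by have := Real.log_two_gt_d9; linarith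
  have hl2' : log 2 < 0.6932 := by have := Real.log_two_lt_d9; linarith
  have h4 : log 4 = 2 * log 2 := by
    rw [show (4:ℝ) = 2 ^ 2 by norm_num, Real.log_pow]; norm_num
  rw [hsq] at hθ
  rw [h4] at hθ2
  have a1 : 2 * log 2 * ((n/4 : ℕ):ℝ) ≤ 2 * log 2 * (n/4) := by gcongr
  have a2 : 2 * r^2 * log n ≤ 2 * r^2 * r := by gcongr
  have a3 : 100 * r^3 ≤ n := by rw [← hr4]; nlinarith [pow_pos hr0 3]
  have a4 : 1000 * r ≤ n := by rw [← hr4]; nlinarith [pow_pos hr0 3, pow_pos hr0 2, sq_nonneg r]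
  nlinarith

open Classical in
theorem big_count (y w : ℕ) (hw : 1 ≤ w) :
    (((Finset.Icc 1 y).filter (fun j => ∃ p, p.Prime ∧ w < p ∧ p ∣ j)).card : ℝ) ≤
      ∑ m ∈ Finset.Icc 1 (y / w), (Nat.primeCounting (y / m) : ℝ) := by
  have hsub : (Finset.Icc 1 y).filter (fun j => ∃ p, p.Prime ∧ w < p ∧ p ∣ j) ⊆
      (Finset.Icc 1 (y/w)).biUnion (fun m => (Nat.primesLE (y/m)).image (fun p => p * m)) := by
    intro j hj
    simp only [Finset.mem_filter, Finset.mem_Icc] at hj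
    obtain ⟨⟨h1, h2⟩, p, hp, hwp, m, rfl⟩ := hj
    have hm : 1 ≤ m := by
      rcases Nat.eq_zero_or_pos m with rfl | h
      · simp at h1
      · exact h
    simp only [Finset.mem_biUnion, Finset.mem_Icc, Finset.mem_image, Nat.mem_primesLE]
    refine ⟨m, ⟨hm, ?_⟩, p, ⟨?_, hp⟩, rfl⟩
    · rw [Nat.le_div_iff_mul_le (by omega)]
      nlinarith
    · rwa [Nat.le_div_iff_mul_le (by omega)]
  have := (Finset.card_le_card hsub).trans Finset.card_biUnion_le
  have h2 : ∑ m ∈ Finset.Icc 1 (y/w), ((Nat.primesLE (y/m)).image (fun p => p * m)).card ≤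
      ∑ m ∈ Finset.Icc 1 (y / w), Nat.primeCounting (y / m) := by
    apply Finset.sum_le_sum
    intro m _
    refine Finset.card_image_le.trans ?_
    simp
  exact_mod_cast this.trans h2


theorem le_of_sq_le_sq_aux (E : ℝ) (h0 : 0 ≤ E) (h : 25 ≤ E ^ 2) : 5 ≤ E := by
  nlinarith

set_option maxHeartbeats 1600000 in
open Classical in
theorem core : ∃ c > (0:ℝ), ∀ᶠ n : ℕ in atTop, 48 ≤ log (log n) ∧ ∃ y : ℕ,
    c * (n * log n / (log (log n)) ^ 2) ≤ y ∧ ∃ a : ℕ → ℕ,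
      ∀ j, 1 ≤ j → j ≤ y → ∃ p, p.Prime ∧ p ≤ n ∧ j ≡ a p [MOD p] := by
  refine ⟨1/28800, by norm_num, ?_⟩
  obtain ⟨T0, hT0⟩ := eventually_atTop.1
    (Chebyshev.eventually_primeCounting_le (ε := 1/2) (by norm_num))
  have tL : Tendsto (fun n : ℕ => log (n:ℝ)) atTop atTop :=
    Real.tendsto_log_atTop.comp tendsto_natCast_atTop_atTop
  have tl : Tendsto (fun n : ℕ => log (log (n:ℝ))) atTop atTop :=
    Real.tendsto_log_atTop.comp tL
  have e1 := tL.eventually ((Real.isLittleO_pow_log_id_atTop (n := 2)).bound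
    (show (0:ℝ) < 1/28800 by norm_num))
  have e2 := tl.eventually (eventually_ge_atTop (48:ℝ))
  have e3 := (tendsto_natCast_atTop_atTop (R := ℝ)).eventually (eventually_ge_atTop (5 * T0))
  filter_upwards [e1, e2, e3, eventually_ge_atTop 1000, large_primes] with n h1 hl hnT hn hlarge
  refine ⟨hl, ?_⟩
  set L := log (n:ℝ) with hL
  set l := log L with hldef
  have hn' : (1000:ℝ) ≤ n := by exact_mod_cast hn
  have hn0 : (0:ℝ) < n := by linarith
  have hL0 : 0 < L := Real.log_pos (by linarith)
  have hl0 : 0 < l := by linarith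
  have hLl : 28800 * l ^ 2 ≤ L := by
    rw [Real.norm_of_nonneg (by positivity)] at h1
    simp only [id] at h1
    rw [Real.norm_of_nonneg hL0.le] at h1
    linarith
  have hL1 : 1 ≤ L := by nlinarith
  have hexpl : exp l = L := Real.exp_log hL0
  have hexpL : exp L = n := Real.exp_log hn0
  -- y
  set Y := 1/14400 * (n * L / l ^ 2) with hY
  have hY2 : 2 * (n:ℝ) ≤ Y := by
    rw [hY, ← mul_div_assoc, le_div_iff₀ (by positivity)]
    nlinarith
  have hYn : Y ≤ 1/14400 * (n * L) := by
    rw [hY]; gcongr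
    apply div_le_self (by positivity)
    nlinarith
  set y := ⌊Y⌋₊ with hy
  have hyY : (y:ℝ) ≤ Y := Nat.floor_le (by linarith)
  have hyY' : Y - 1 < y := Nat.sub_one_lt_floor Y
  have hyn : (n:ℝ) ≤ y := by linarith
  have hy0 : (0:ℝ) < y := by linarith
  have hynN : n ≤ y := by exact_mod_cast hyn
  refine ⟨y, by linarith, ?_⟩
  -- K
  set t := L / (50 * l) with ht
  have ht4 : 4 ≤ t := by
    rw [ht, le_div_iff₀ (by positivity)]; nlinarith
  have htL : t ≤ L / 2 := by
    rw [ht]; gcongr; linarith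
  set K := ⌊t⌋₊ with hK
  have hKt : (K:ℝ) ≤ t := Nat.floor_le (by linarith)
  have hKt' : t - 1 < K := Nat.sub_one_lt_floor t
  have hK3 : 3 ≤ K := by
    have : (3:ℝ) ≤ ⌊t⌋₊ := by linarith
    exact_mod_cast this
  have hK0 : (0:ℝ) < K := by linarith
  have hl2 : 0.6931 < log 2 := by have := Real.log_two_gt_d9; linarith
  have hl2' : log 2 < 0.6932 := by have := Real.log_two_lt_d9; linarith
  -- w
  set w := n / 4 with hw
  have hw5 : (n:ℝ) / 5 ≤ w := by
    rw [div_le_iff₀ (by norm_num)]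
    have : n ≤ w * 5 := by omega
    exact_mod_cast this
  have hwsq : exp (L/2) ≤ w := by
    refine le_trans ?_ hw5
    have hsq : exp (L/2) ^ 2 = n := by rw [← hexpL, ← Real.exp_nat_mul]; congr 1; push_cast; ring
    have : 0 < exp (L/2) := Real.exp_pos _
    rw [← hsq] at hn' ⊢
    have h5 : 5 ≤ exp (L/2) := le_of_sq_le_sq_aux _ this.le (by linarith)
    have h6 := mul_le_mul_of_nonneg_right h5 this.le
    rw [sq]
    linarith
  have hw0 : (0:ℝ) < w := by linarith
  have hlogw : L / 2 ≤ log w := by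
    rw [Real.le_log_iff_exp_le hw0]; exact hwsq
  have hzw : 2 ^ K ≤ w + 1 := by
    have : ((2 ^ K : ℕ):ℝ) ≤ w := by
      refine le_trans ?_ hwsq
      push_cast
      rw [← Real.exp_log (show (0:ℝ) < 2 ^ K by positivity), Real.log_pow]
      apply Real.exp_le_exp.2
      nlinarith
    have : 2 ^ K ≤ w := by exact_mod_cast this
    omega
  apply cover n y (2 ^ K) w hzw (by omega)
  -- smooth part
  have hsm : (((Finset.Icc 1 y).filter (fun j => j ∈ Nat.smoothNumbers (2 ^ K))).card : ℝ) ≤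
      y * l / L := by
    refine (smooth_count K y hK3 (by omega)).trans ?_
    have hlogy : L ≤ log y := Real.log_le_log hn0 hyn
    have b1 : 50 * l ≤ log y / (K * log 2) := by
      rw [le_div_iff₀ (by positivity)]
      have : 50 * l * t = L := by rw [ht]; field_simp
      have b2 : K * log 2 ≤ t := by nlinarith
      nlinarith
    have b3 : log K ≤ l := Real.log_le_log hK0 (by linarith)
    have b4 : exp (- (log y / (K * log 2)) + 48 * (1 + log K)) ≤ exp (-l) :=
      Real.exp_le_exp.2 (by linarith)
    rw [Real.exp_neg, hexpl] at b4
    calc _ ≤ (y:ℝ) * L⁻¹ := by gcongr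
      _ = y * 1 / L := by ring
      _ ≤ y * l / L := by gcongr; linarith
  -- big part
  have hbig : (((Finset.Icc 1 y).filter (fun j => ∃ p, p.Prime ∧ w < p ∧ p ∣ j)).card : ℝ) ≤
      8 * (y * l / L) := by
    refine (big_count y w (by omega)).trans ?_
    have hterm : ∀ m ∈ Finset.Icc 1 (y / w), (Nat.primeCounting (y / m) : ℝ) ≤
        (4 * y / L) * (m:ℝ)⁻¹ := by
      intro m hm
      rw [Finset.mem_Icc] at hm
      have hm0 : (0:ℝ) < m := by exact_mod_cast hm.1
      have hwy : w ≤ y / m := by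
        rw [Nat.le_div_iff_mul_le (by omega)]
        have := (Nat.le_div_iff_mul_le (by omega : 0 < w)).1 hm.2
        rwa [mul_comm]
      have hwy' : (w:ℝ) ≤ (y / m : ℕ) := by exact_mod_cast hwy
      have c1 := hT0 ((y/m : ℕ):ℝ) (by linarith)
      rw [Nat.floor_natCast] at c1
      have c2 : L / 2 ≤ log ((y/m : ℕ):ℝ) := hlogw.trans (Real.log_le_log hw0 hwy')
      have c3 : ((y/m : ℕ):ℝ) ≤ y / m := Nat.cast_div_le
      have h4 : log 4 = 2 * log 2 := by
        rw [show (4:ℝ) = 2 ^ 2 by norm_num, Real.log_pow]; norm_num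
      have c4 : log 4 + 1/2 ≤ 2 := by rw [h4]; linarith
      calc (Nat.primeCounting (y / m) : ℝ) ≤ _ := c1
        _ ≤ 2 * (y / m) / (L / 2) := by gcongr
        _ = (4 * y / L) * (m:ℝ)⁻¹ := by field_simp; norm_num
    refine (Finset.sum_le_sum hterm).trans ?_
    rw [← Finset.mul_sum]
    have hh := harmonic_le_one_add_log (y / w)
    rw [harmonic_eq_sum_Icc] at hh
    push_cast at hh
    have hyw1 : 1 ≤ y / w := by
      rw [Nat.le_div_iff_mul_le (by omega)]; omega
    have hyw : ((y / w : ℕ):ℝ) ≤ L := by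
      refine Nat.cast_div_le.trans ?_
      rw [div_le_iff₀ hw0]
      nlinarith
    have hlog : log ((y / w : ℕ):ℝ) ≤ l :=
      Real.log_le_log (by exact_mod_cast hyw1) hyw
    calc (4 * y / L) * ∑ m ∈ Finset.Icc 1 (y / w), (m:ℝ)⁻¹ ≤ (4 * y / L) * (2 * l) := by
          gcongr; linarith
      _ = 8 * (y * l / L) := by ring
  -- total
  have htot : (((Finset.Icc 1 y).filter
      (fun j => ∀ p, p.Prime → 2 ^ K ≤ p → p ≤ w → ¬ p ∣ j)).card : ℝ) ≤ 9 * (y * l / L) := by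
    have hsub : (Finset.Icc 1 y).filter (fun j => ∀ p, p.Prime → 2 ^ K ≤ p → p ≤ w → ¬ p ∣ j) ⊆
        (Finset.Icc 1 y).filter (fun j => j ∈ Nat.smoothNumbers (2 ^ K)) ∪
        (Finset.Icc 1 y).filter (fun j => ∃ p, p.Prime ∧ w < p ∧ p ∣ j) := by
      intro j hj
      rw [Finset.mem_filter] at hj
      rw [Finset.mem_union, Finset.mem_filter, Finset.mem_filter]
      by_cases hb : ∃ p, p.Prime ∧ w < p ∧ p ∣ j
      · exact Or.inr ⟨hj.1, hb⟩
      · left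
        refine ⟨hj.1, Nat.mem_smoothNumbers'.2 fun p hp hpj => ?_⟩
        by_contra hc
        exact hj.2 p hp (by omega) (by by_contra hc2; exact hb ⟨p, hp, by omega, hpj⟩) hpj
    have := (Finset.card_le_card hsub).trans (Finset.card_union_le _ _)
    have h' : (((Finset.Icc 1 y).filter
      (fun j => ∀ p, p.Prime → 2 ^ K ≤ p → p ≤ w → ¬ p ∣ j)).card : ℝ) ≤
      (((Finset.Icc 1 y).filter (fun j => j ∈ Nat.smoothNumbers (2 ^ K))).card : ℝ) +
      (((Finset.Icc 1 y).filter (fun j => ∃ p, p.Prime ∧ w < p ∧ p ∣ j)).card : ℝ) := by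
      exact_mod_cast this
    linarith
  have hmer := mertens_ub (2 ^ K) (by
    calc 2 = 2 ^ 1 := rfl
      _ ≤ 2 ^ K := Nat.pow_le_pow_right (by norm_num) (by omega))
  have hmer2 : ∏ p ∈ Nat.primesBelow (2 ^ K), (1 - 1 / (p:ℝ)) ≤ 200 * l / L := by
    refine hmer.trans ?_
    push_cast
    rw [Real.log_pow, div_le_div_iff₀ (by positivity) hL0]
    have : 50 * l * t = L := by rw [ht]; field_simp
    have k1 : t / 4 ≤ K * log 2 := by nlinarith
    nlinarith
  refine le_trans ?_ hlarge
  calc _ ≤ 9 * (y * l / L) * (200 * l / L) := by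
        apply mul_le_mul htot hmer2 _ (by positivity)
        apply Finset.prod_nonneg
        intro p hp
        have : (1:ℝ) ≤ p := by exact_mod_cast (Nat.prime_of_mem_primesBelow hp).one_le
        rw [sub_nonneg, div_le_one (by linarith)]; exact this
    _ ≤ 9 * (Y * l / L) * (200 * l / L) := by gcongr
    _ = (n:ℝ) / (8 * L) := by rw [hY]; field_simp; norm_num

/-- (Erdős, 1935) `G(X) ≫ log X · log₂ X / (log₃ X)²`. -/
theorem erdos_large_gaps :
    ∃ C > (0 : ℝ), ∀ᶠ X : ℝ in atTop,
      G X ≥ C * (Real.log X * iterlog 2 X) / (iterlog 3 X) ^ 2 := by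
  obtain ⟨c, hc, hcore⟩ := core
  refine ⟨c / 16, by positivity, ?_⟩
  have tn : Tendsto (fun X : ℝ => ⌊log X / 4⌋₊) atTop atTop :=
    tendsto_nat_floor_atTop.comp (Real.tendsto_log_atTop.atTop_div_const (by norm_num))
  filter_upwards [tn.eventually hcore, Real.tendsto_log_atTop.eventually_ge_atTop 1000,
    eventually_gt_atTop 0] with X hX hL hX0
  obtain ⟨hl, y, hy, a, ha⟩ := hX
  have i2 : iterlog 2 X = log (log X) := rfl
  have i3 : iterlog 3 X = log (log (log X)) := rfl
  rw [i2, i3]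
  set n := ⌊log X / 4⌋₊ with hn
  set M := log X with hM
  have hn1 : (n:ℝ) ≤ M / 4 := Nat.floor_le (by linarith)
  have hn2 : M / 4 - 1 < n := Nat.sub_one_lt_floor _
  have hn8 : M / 8 ≤ n := by linarith
  have hn0 : (0:ℝ) < n := by linarith
  have hn2' : 2 ≤ n := by
    have : (2:ℝ) ≤ ⌊log X / 4⌋₊ := by linarith
    exact_mod_cast this
  obtain ⟨N, hN2, hN4, hN⟩ := gap_of_cover n y hn2' a ha
  have hl4 : log 4 ≤ 1.4 := by
    have h4 : log 4 = 2 * log 2 := by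
      rw [show (4:ℝ) = 2 ^ 2 by norm_num, Real.log_pow]; norm_num
    have := Real.log_two_lt_d9
    linarith
  have hNX : ((2 * N : ℕ):ℝ) ≤ X := by
    have h1 : 2 * N ≤ 4 ^ (n+1) := by rw [pow_succ]; omega
    have h2 : ((2 * N : ℕ):ℝ) ≤ 4 ^ (n+1) := by exact_mod_cast h1
    refine h2.trans ?_
    rw [← Real.log_le_log_iff (by positivity) hX0, Real.log_pow]
    push_cast
    nlinarith
  have hG := G_ge X N y hN2 hNX hN
  refine le_trans ?_ (hy.trans hG)
  have hM0 : 0 < M := by linarith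
  have hlM : log M / 2 ≤ log n := by
    have h64 : √M ≤ M / 8 := by
      rw [Real.sqrt_le_left (by positivity)]; nlinarith
    calc log M / 2 = log √M := (Real.log_sqrt hM0.le).symm
      _ ≤ log n := Real.log_le_log (by positivity) (h64.trans hn8)
  have hlM0 : 0 < log M := Real.log_pos (by linarith)
  have hln0 : 0 < log (n:ℝ) := by linarith
  have hll : log (log (n:ℝ)) ≤ log (log M) :=
    Real.log_le_log hln0 (Real.log_le_log hn0 (by linarith))
  calc c / 16 * (M * log M) / log (log M) ^ 2
      = c * ((M / 8) * (log M / 2) / log (log M) ^ 2) := by ring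
    _ ≤ c * (n * log n / log (log n) ^ 2) := by gcongr
end

section
/- (Rankin, 1938) There exists a constant c > 0 such that for every ε > 0 there is X_0 with the property that for all X ≥ X_0 one has G(X) ≥ (c − ε) · (log X · log_2 X · log_4 X) / (log_3 X)^2. -/
open Real Filter

lemma rk_greedy (S : Finset ℕ) (Q : Finset ℕ) (hQ : ∀ p ∈ Q, p.Prime) :
    ∃ a : ℕ → ℕ, ((S.filter (fun n => ∀ p ∈ Q, ¬ n ≡ a p [MOD p])).card : ℝ) ≤
      S.card * ∏ p ∈ Q, (1 - 1 / (p : ℝ)) := by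
  classical
  induction Q using Finset.induction_on with
  | empty => exact ⟨fun _ => 0, by simp⟩
  | insert q Q hq ih =>
    obtain ⟨a, ha⟩ := ih (fun p hp => hQ p (Finset.mem_insert_of_mem hp))
    have hqp : q.Prime := hQ q (Finset.mem_insert_self _ _)
    have hq0 : (0 : ℝ) < q := by exact_mod_cast hqp.pos
    set R := S.filter (fun n => ∀ p ∈ Q, ¬ n ≡ a p [MOD p]) with hR
    have hmaps : ∀ n ∈ R, n % q ∈ Finset.range q := fun n _ =>
      Finset.mem_range.2 (Nat.mod_lt _ hqp.pos)
    have hne : (Finset.range q).Nonempty := ⟨0, Finset.mem_range.2 hqp.pos⟩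
    obtain ⟨b, hb, hbc⟩ := Finset.exists_le_card_fiber_of_nsmul_le_card_of_maps_to
      (M := ℝ) (b := (R.card : ℝ) / q) hmaps hne (by
        rw [Finset.card_range, nsmul_eq_mul]; field_simp; rfl)
    refine ⟨Function.update a q b, ?_⟩
    have hsub : S.filter (fun n => ∀ p ∈ insert q Q, ¬ n ≡ Function.update a q b p [MOD p])
        ⊆ R.filter (fun n => ¬ n % q = b) := by
      intro n hn
      rw [Finset.mem_filter] at hn
      rw [Finset.mem_filter, hR, Finset.mem_filter]
      refine ⟨⟨hn.1, fun p hp => ?_⟩, ?_⟩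
      · have := hn.2 p (Finset.mem_insert_of_mem hp)
        rwa [Function.update_of_ne (by rintro rfl; exact hq hp)] at this
      · have := hn.2 q (Finset.mem_insert_self _ _)
        rw [Function.update_self] at this
        intro h
        apply this
        rw [Nat.ModEq, h, Nat.mod_eq_of_lt (Finset.mem_range.1 hb)]
    have h1 := Finset.card_le_card hsub
    have h2 := Finset.card_filter_add_card_filter_not (s := R) (fun n => n % q = b)
    have h3 : ((R.filter (fun n => ¬ n % q = b)).card : ℝ) ≤ R.card * (1 - 1 / q) := by
      have : ((R.filter (fun n => n % q = b)).card : ℝ) +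
        ((R.filter (fun n => ¬ n % q = b)).card : ℝ) = R.card := by exact_mod_cast h2
      have e : (R.card : ℝ) * (1 - 1 / q) = R.card - R.card / q := by ring
      rw [e]; linarith
    rw [Finset.prod_insert hq]
    have h4 : (0:ℝ) ≤ 1 - 1 / q := by
      rw [sub_nonneg, div_le_one hq0]; exact_mod_cast hqp.one_le
    calc _ ≤ ((R.filter (fun n => ¬ n % q = b)).card : ℝ) := by exact_mod_cast h1
      _ ≤ R.card * (1 - 1 / q) := h3
      _ ≤ (S.card * ∏ p ∈ Q, (1 - 1 / (p : ℝ))) * (1 - 1 / q) := by gcongr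
      _ = _ := by ring

lemma rk_match (R Q : Finset ℕ) (h : R.card ≤ Q.card) :
    ∃ a : ℕ → ℕ, ∀ n ∈ R, ∃ p ∈ Q, n = a p := by
  classical
  obtain ⟨f⟩ : Nonempty (R ↪ Q) := Function.Embedding.nonempty_of_card_le (by simpa using h)
  refine ⟨fun p => if h : ∃ r : R, (f r : ℕ) = p then (h.choose : ℕ) else 0,
    fun n hn => ⟨f ⟨n, hn⟩, (f ⟨n, hn⟩).2, ?_⟩⟩
  have hex : ∃ r : R, (f r : ℕ) = (f ⟨n, hn⟩ : ℕ) := ⟨⟨n, hn⟩, rfl⟩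
  have hc := hex.choose_spec
  have := f.injective (Subtype.ext hc)
  simp only [dif_pos hex]
  rw [this]

def rkP (a b : ℕ) : Finset ℕ := (Finset.Ioc a b).filter Nat.Prime

lemma mem_rkP {a b p : ℕ} : p ∈ rkP a b ↔ (a < p ∧ p ≤ b) ∧ p.Prime := by
  simp [rkP]

lemma rk_cover (Y Z N M : ℕ) (hYZ : Y ≤ Z) (hZN : Z ≤ N)
    (h : ((((Finset.Icc 1 M).filter (fun n => n ∈ Nat.smoothNumbers (Y+1))).card : ℝ) +
      ∑ p ∈ rkP Z M, (M : ℝ) / p) * ∏ p ∈ rkP 0 Y, (1 - 1 / (p : ℝ)) ≤ (rkP Z N).card) :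
    ∃ a : ℕ → ℕ, ∀ n ∈ Finset.Icc 1 M, ∃ p ∈ rkP 0 N, n ≡ a p [MOD p] := by
  classical
  set S := (Finset.Icc 1 M).filter (fun n => ∀ p ∈ rkP Y Z, ¬ p ∣ n) with hS
  have hScard : (S.card : ℝ) ≤ (((Finset.Icc 1 M).filter (fun n => n ∈ Nat.smoothNumbers (Y+1))).card : ℝ) +
      ∑ p ∈ rkP Z M, (M : ℝ) / p := by
    have hsub : S ⊆ ((Finset.Icc 1 M).filter (fun n => n ∈ Nat.smoothNumbers (Y+1))) ∪
        (rkP Z M).biUnion (fun p => (Finset.Ioc 0 M).filter (fun n => p ∣ n)) := by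
      intro n hn
      rw [hS, Finset.mem_filter, Finset.mem_Icc] at hn
      obtain ⟨⟨hn1, hnM⟩, hn2⟩ := hn
      rw [Finset.mem_union]
      by_cases hsm : n ∈ Nat.smoothNumbers (Y+1)
      · left; simp [hn1, hnM, hsm]
      · right
        rw [Nat.mem_smoothNumbers'] at hsm
        push Not at hsm
        obtain ⟨p, hp, hpn, hYp⟩ := hsm
        have hpM := Nat.le_of_dvd hn1 hpn
        have hZp : Z < p := by
          by_contra hc
          exact hn2 p (mem_rkP.2 ⟨⟨by omega, by omega⟩, hp⟩) hpn
        rw [Finset.mem_biUnion]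
        refine ⟨p, mem_rkP.2 ⟨⟨hZp, by omega⟩, hp⟩, ?_⟩
        simp [hpn, hnM]; omega
    have h1 := (Finset.card_le_card hsub).trans (Finset.card_union_le _ _)
    have h2 : (((rkP Z M).biUnion (fun p => (Finset.Ioc 0 M).filter (fun n => p ∣ n))).card : ℝ)
        ≤ ∑ p ∈ rkP Z M, (M : ℝ) / p := by
      calc _ ≤ ((∑ p ∈ rkP Z M, ((Finset.Ioc 0 M).filter (fun n => p ∣ n)).card : ℕ) : ℝ) := by
            exact_mod_cast Finset.card_biUnion_le
        _ ≤ _ := by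
          push_cast
          apply Finset.sum_le_sum
          intro p hp
          rw [Nat.Ioc_filter_dvd_card_eq_div]
          exact Nat.cast_div_le
    have h3 : (S.card : ℝ) ≤ _ := Nat.cast_le.2 h1
    push_cast at h3
    linarith
  obtain ⟨a₁, ha₁⟩ := rk_greedy S (rkP 0 Y) (fun p hp => (mem_rkP.1 hp).2)
  set R := S.filter (fun n => ∀ p ∈ rkP 0 Y, ¬ n ≡ a₁ p [MOD p]) with hR
  have hRc : R.card ≤ (rkP Z N).card := by
    have : (R.card : ℝ) ≤ (rkP Z N).card := by
      refine ha₁.trans (le_trans ?_ h)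
      apply mul_le_mul_of_nonneg_right hScard
      apply Finset.prod_nonneg
      intro p hp
      have := (mem_rkP.1 hp).2
      have hp0 : (0:ℝ) < p := by exact_mod_cast this.pos
      rw [sub_nonneg, div_le_one hp0]; exact_mod_cast this.one_le
    exact_mod_cast this
  obtain ⟨a₂, ha₂⟩ := rk_match R _ hRc
  refine ⟨fun p => if p ≤ Y then a₁ p else if p ≤ Z then 0 else a₂ p, fun n hn => ?_⟩
  by_cases h1 : n ∈ S
  · by_cases h2 : n ∈ R
    · obtain ⟨p, hp, rfl⟩ := ha₂ n h2
      obtain ⟨⟨hp1, hp2⟩, hp3⟩ := mem_rkP.1 hp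
      refine ⟨p, mem_rkP.2 ⟨⟨by omega, hp2⟩, hp3⟩, ?_⟩
      simp only [if_neg (show ¬ p ≤ Y by omega), if_neg (show ¬ p ≤ Z by omega)]; rfl
    · rw [hR, Finset.mem_filter] at h2
      push Not at h2
      obtain ⟨p, hp, hpa⟩ := h2 h1
      obtain ⟨⟨hp1, hp2⟩, hp3⟩ := mem_rkP.1 hp
      refine ⟨p, mem_rkP.2 ⟨⟨hp1, by omega⟩, hp3⟩, ?_⟩
      simp only [if_pos hp2]; exact hpa
  · rw [hS, Finset.mem_filter] at h1
    push Not at h1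
    obtain ⟨p, hp, hpa⟩ := h1 hn
    obtain ⟨⟨hp1, hp2⟩, hp3⟩ := mem_rkP.1 hp
    refine ⟨p, mem_rkP.2 ⟨⟨by omega, by omega⟩, hp3⟩, ?_⟩
    simp only [if_neg (show ¬ p ≤ Y by omega), if_pos hp2]
    exact (Nat.modEq_zero_iff_dvd).2 hpa

lemma rk_crt (N M : ℕ) (hN : 2 ≤ N) (a : ℕ → ℕ)
    (h : ∀ n ∈ Finset.Icc 1 M, ∃ p ∈ rkP 0 N, n ≡ a p [MOD p]) :
    ∃ m, 2 ≤ m ∧ m ≤ 2 * 4 ^ N ∧ ∀ n ∈ Finset.Icc 1 M, ¬ (m + n).Prime := by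
  classical
  set P := ∏ p ∈ rkP 0 N, p with hP
  have hPpos : 0 < P := Finset.prod_pos (fun p hp => (mem_rkP.1 hp).2.pos)
  have hPle : P ≤ 4 ^ N := by
    refine le_trans (le_of_eq ?_) (primorial_le_four_pow N)
    rw [hP, primorial]
    apply Finset.prod_congr _ (fun _ _ => rfl)
    ext p
    rw [mem_rkP]
    simp only [Finset.mem_filter, Finset.mem_range]
    constructor
    · rintro ⟨⟨_, h⟩, h'⟩; exact ⟨by omega, h'⟩
    · rintro ⟨h, h'⟩; exact ⟨⟨h'.pos, by omega⟩, h'⟩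
  have hco : Set.Pairwise (↑(rkP 0 N) : Set ℕ) (Function.onFun Nat.Coprime (fun p : ℕ => p)) := by
    intro p hp q hq hpq
    exact (Nat.coprime_primes (mem_rkP.1 hp).2 (mem_rkP.1 hq).2).2 hpq
  obtain ⟨k, hk⟩ := Nat.chineseRemainderOfFinset (fun p => p * a p - a p) (fun p => p) (rkP 0 N)
    (fun p hp => (mem_rkP.1 hp).2.ne_zero) hco
  have hP2 : 2 ≤ P := Nat.le_of_dvd hPpos
    (Finset.dvd_prod_of_mem _ (mem_rkP.2 ⟨⟨by omega, hN⟩, Nat.prime_two⟩))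
  refine ⟨k % P + P, by omega, ?_, ?_⟩
  · have := Nat.mod_lt k hPpos; omega
  intro n hn hpr
  obtain ⟨p, hp, hpa⟩ := h n hn
  have hpp := (mem_rkP.1 hp).2
  have hpP : p ∣ P := Finset.dvd_prod_of_mem _ hp
  have hdvd : p ∣ k % P + P + n := by
    have h1 : k % P ≡ k [MOD p] := (Nat.mod_modEq k P).of_dvd hpP
    have h2 : k % P + P + n ≡ (p * a p - a p) + 0 + a p [MOD p] :=
      ((h1.trans (hk p hp)).add ((Nat.modEq_zero_iff_dvd).2 hpP)).add hpa
    have h3 : (p * a p - a p) + 0 + a p = p * a p := by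
      have : a p ≤ p * a p := Nat.le_mul_of_pos_left _ hpp.pos
      omega
    rw [h3] at h2
    exact (Nat.modEq_zero_iff_dvd).1 (h2.trans ((Nat.modEq_zero_iff_dvd).2 (dvd_mul_right _ _)))
  have hle := Nat.le_of_dvd hPpos hpP
  have hn1 := (Finset.mem_Icc.1 hn).1
  rcases (Nat.dvd_prime hpr).1 hdvd with h1 | h1
  · exact hpp.one_lt.ne' h1
  · omega

lemma rk_gap (m M : ℕ) (X : ℝ) (hm : 2 ≤ m) (hX : (2 * (m + M) : ℝ) ≤ X)
    (h : ∀ n ∈ Finset.Icc 1 M, ¬ (m + n).Prime) : (M + 1 : ℝ) ≤ G X := by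
  classical
  set k := Nat.count Nat.Prime (m + 1) with hk
  have hk1 : 1 ≤ k := by
    have : Nat.count Nat.Prime 3 ≤ k := Nat.count_monotone _ (by omega)
    have h3 : Nat.count Nat.Prime 3 = 1 := by decide
    omega
  have hinf := Nat.infinite_setOfPred_prime
  have hlow : nthPrime k ≤ m := by
    have : nthPrime k < m + 1 := by
      unfold nthPrime
      exact Nat.nth_lt_of_lt_count (by omega)
    omega
  have hpk : (Nat.nth Nat.Prime k).Prime := Nat.prime_nth_prime k
  have hhigh : m + M + 1 ≤ nthPrime (k + 1) := by
    have h1 : m + 1 ≤ Nat.nth Nat.Prime k := Nat.le_nth_count hinf _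
    unfold nthPrime
    rw [Nat.add_sub_cancel]
    by_contra hc
    apply h (Nat.nth Nat.Prime k - m) (Finset.mem_Icc.2 ⟨by omega, by omega⟩)
    rwa [Nat.add_sub_cancel' (by omega)]
  have hup : nthPrime (k + 1) ≤ 2 * (m + M) := by
    obtain ⟨q, hq, hq1, hq2⟩ := Nat.exists_prime_lt_and_le_two_mul (m + M) (by omega)
    refine le_trans ?_ hq2
    unfold nthPrime
    rw [Nat.add_sub_cancel]
    have h1 := Nat.nth_count hq
    rw [← h1]
    exact Nat.nth_monotone hinf (Nat.count_monotone _ (by omega))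
  have hup' : (nthPrime (k + 1) : ℝ) ≤ X := le_trans (by exact_mod_cast hup) hX
  have hmem : (nthPrime (k + 1) : ℝ) - nthPrime k ∈ {d : ℝ | ∃ n : ℕ, 1 ≤ n ∧ (nthPrime (n + 1) : ℝ) ≤ X ∧
    d = (nthPrime (n + 1) : ℝ) - nthPrime n} := ⟨k, hk1, hup', rfl⟩
  have hb : BddAbove {d : ℝ | ∃ n : ℕ, 1 ≤ n ∧ (nthPrime (n + 1) : ℝ) ≤ X ∧
    d = (nthPrime (n + 1) : ℝ) - nthPrime n} := by
    refine ⟨X, ?_⟩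
    rintro d ⟨n, _, hn, rfl⟩
    have : (0:ℝ) ≤ nthPrime n := Nat.cast_nonneg _
    linarith
  refine le_trans ?_ (le_csSup hb hmem)
  have h1 : (nthPrime k : ℝ) ≤ m := by exact_mod_cast hlow
  have h2 : (m + M + 1 : ℝ) ≤ nthPrime (k + 1) := by exact_mod_cast hhigh
  linarith

lemma rk_theta (n : ℕ) : ∑ p ∈ rkP 0 n, Real.log p ≤ Real.log 4 * n := by
  have h := Chebyshev.theta_le_log4_mul_x (x := (n : ℝ)) (Nat.cast_nonneg _)
  refine le_trans (le_of_eq ?_) h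
  rw [Chebyshev.theta, Nat.floor_natCast]; rfl

lemma rk_dyadic (a : ℕ) (ha : 1 ≤ a) :
    ∑ p ∈ rkP a (2 * a), Real.log p / p ≤ 4 * Real.log 2 := by
  have ha' : (0:ℝ) < a := by exact_mod_cast ha
  have h1 : ∑ p ∈ rkP a (2 * a), Real.log p / p ≤ ∑ p ∈ rkP a (2 * a), Real.log p / a := by
    apply Finset.sum_le_sum
    intro p hp
    obtain ⟨⟨h1, h2⟩, h3⟩ := mem_rkP.1 hp
    have : (a : ℝ) ≤ p := by exact_mod_cast h1.le
    have : 0 ≤ Real.log p := Real.log_natCast_nonneg p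
    gcongr
  have h2 : ∑ p ∈ rkP a (2 * a), Real.log p ≤ ∑ p ∈ rkP 0 (2 * a), Real.log p := by
    apply Finset.sum_le_sum_of_subset_of_nonneg
    · intro p hp
      obtain ⟨⟨h1, h2⟩, h3⟩ := mem_rkP.1 hp
      exact mem_rkP.2 ⟨⟨by omega, h2⟩, h3⟩
    · intro p _ _; exact Real.log_natCast_nonneg p
  have h3 := rk_theta (2 * a)
  rw [← Finset.sum_div] at h1
  refine h1.trans ?_
  rw [div_le_iff₀ ha']
  have h4 : Real.log 4 = 2 * Real.log 2 := by
    rw [show (4:ℝ) = 2 ^ 2 by norm_num, Real.log_pow]; norm_num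
  rw [h4] at h3
  push_cast at h3
  nlinarith

lemma rkP_sum_split (f : ℕ → ℝ) (a b c : ℕ) (hab : a ≤ b) (hbc : b ≤ c) :
    ∑ p ∈ rkP a c, f p = ∑ p ∈ rkP a b, f p + ∑ p ∈ rkP b c, f p := by
  unfold rkP
  rw [← Finset.sum_union]
  · rw [← Finset.filter_union, Finset.Ioc_union_Ioc_eq_Ioc hab hbc]
  · apply Finset.disjoint_filter_filter
    rw [Finset.disjoint_left]
    intro x hx hy
    rw [Finset.mem_Ioc] at hx hy
    omega

lemma rk_dyadic_pow (a : ℕ) (ha : 1 ≤ a) (k : ℕ) :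
    ∑ p ∈ rkP a (2 ^ k * a), Real.log p / p ≤ k * (4 * Real.log 2) := by
  induction k with
  | zero => simp [rkP]
  | succ k ih =>
    have hp : 1 ≤ 2 ^ k := Nat.one_le_two_pow
    have h1 : a ≤ 2 ^ k * a := Nat.le_mul_of_pos_left _ hp
    rw [rkP_sum_split _ a (2 ^ k * a) _ h1 (by rw [pow_succ]; nlinarith)]
    have h2 := rk_dyadic (2 ^ k * a) (by omega)
    rw [show 2 ^ (k + 1) * a = 2 * (2 ^ k * a) by ring]
    push_cast
    linarith

lemma rk_mertens1 (a b : ℕ) (ha : 1 ≤ a) (hab : a ≤ b) :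
    ∑ p ∈ rkP a b, Real.log p / p ≤ 4 * Real.log (b / a) + 3 := by
  have ha' : (0:ℝ) < a := by exact_mod_cast ha
  have hb' : (a:ℝ) ≤ b := by exact_mod_cast hab
  have hl2 : 0 < Real.log 2 := Real.log_pos (by norm_num)
  have hl2' := Real.log_two_lt_d9
  have hnn : 0 ≤ Real.log ((b:ℝ) / a) := Real.log_nonneg (by rw [le_div_iff₀ ha']; linarith)
  set k := ⌈Real.log ((b:ℝ) / a) / Real.log 2⌉₊ with hk
  have hk1 : Real.log ((b:ℝ) / a) / Real.log 2 ≤ k := Nat.le_ceil _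
  have hk2 : (k:ℝ) < Real.log ((b:ℝ) / a) / Real.log 2 + 1 := Nat.ceil_lt_add_one (by positivity)
  have hbk : b ≤ 2 ^ k * a := by
    have : (b:ℝ) / a ≤ 2 ^ k := by
      rw [← Real.log_le_log_iff (div_pos (by linarith) ha') (by positivity), Real.log_pow]
      rwa [div_le_iff₀ hl2] at hk1
    rw [div_le_iff₀ ha'] at this
    exact_mod_cast this
  have h1 : ∑ p ∈ rkP a b, Real.log p / p ≤ ∑ p ∈ rkP a (2 ^ k * a), Real.log p / p := by
    apply Finset.sum_le_sum_of_subset_of_nonneg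
    · intro p hp
      obtain ⟨⟨h1, h2⟩, h3⟩ := mem_rkP.1 hp
      exact mem_rkP.2 ⟨⟨by omega, by omega⟩, h3⟩
    · intro p _ _; exact div_nonneg (Real.log_natCast_nonneg p) (Nat.cast_nonneg _)
  have h2 := rk_dyadic_pow a ha k
  have h3 : (k:ℝ) * (4 * Real.log 2) ≤ 4 * Real.log (b / a) + 4 * Real.log 2 := by
    have : (k:ℝ) * Real.log 2 ≤ (Real.log ((b:ℝ) / a) / Real.log 2 + 1) * Real.log 2 := by gcongr
    rw [add_mul, div_mul_cancel₀ _ hl2.ne'] at this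
    linarith
  linarith

lemma rkP_zero_one (b : ℕ) : rkP 0 b = rkP 1 b := by
  ext p
  rw [mem_rkP, mem_rkP]
  constructor
  · rintro ⟨⟨h1, h2⟩, h3⟩; exact ⟨⟨h3.one_lt, h2⟩, h3⟩
  · rintro ⟨⟨h1, h2⟩, h3⟩; exact ⟨⟨h3.pos, h2⟩, h3⟩

lemma rk_mertens2 (a b : ℕ) (ha : 2 ≤ a) (hab : a ≤ b) :
    ∑ p ∈ rkP a b, 1 / (p:ℝ) ≤ (4 * Real.log (b / a) + 3) / Real.log a := by
  have hla : 0 < Real.log a := Real.log_pos (by exact_mod_cast ha)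
  rw [le_div_iff₀ hla, Finset.sum_mul]
  refine le_trans ?_ (rk_mertens1 a b (by omega) hab)
  apply Finset.sum_le_sum
  intro p hp
  obtain ⟨⟨h1, h2⟩, h3⟩ := mem_rkP.1 hp
  have : Real.log a ≤ Real.log p := Real.log_le_log (by positivity) (by exact_mod_cast h1.le)
  rw [one_div_mul_eq_div]
  gcongr

lemma rk_mertens3_aux (j : ℕ) : ∑ p ∈ rkP 0 (2 ^ (2 ^ j)), 1 / (p:ℝ) ≤ 9 * j + 1 := by
  induction j with
  | zero =>
    have : rkP 0 (2 ^ (2 ^ 0)) = {2} := by decide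
    rw [this]; norm_num
  | succ j ih =>
    have hj : 1 ≤ 2 ^ j := Nat.one_le_two_pow
    have h2 : 2 ≤ 2 ^ (2 ^ j) := by
      calc 2 = 2 ^ 1 := by norm_num
        _ ≤ _ := Nat.pow_le_pow_right (by norm_num) hj
    have hle : 2 ^ (2 ^ j) ≤ 2 ^ (2 ^ (j + 1)) :=
      Nat.pow_le_pow_right (by norm_num) (Nat.pow_le_pow_right (by norm_num) (by omega))
    rw [rkP_sum_split _ 0 (2 ^ (2 ^ j)) _ (by omega) hle]
    have h3 := rk_mertens2 _ _ h2 hle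
    have hl2 := Real.log_two_gt_d9
    have hq : ((2 ^ (2 ^ (j + 1)) : ℕ) : ℝ) / ((2 ^ (2 ^ j) : ℕ) : ℝ) = 2 ^ (2 ^ j) := by
      push_cast
      rw [pow_succ 2 j, pow_mul, sq, mul_div_assoc, div_self (by positivity), mul_one]
    rw [hq] at h3
    push_cast at h3
    rw [Real.log_pow] at h3
    have hj' : (1:ℝ) ≤ ((2 ^ j : ℕ) : ℝ) := by exact_mod_cast hj
    set J : ℝ := ((2 ^ j : ℕ) : ℝ) with hJ
    have : (4 * (J * Real.log 2) + 3) / (J * Real.log 2) ≤ 9 := by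
      rw [div_le_iff₀ (by positivity)]
      nlinarith
    push_cast at *
    linarith

lemma rk_mertens3 (b : ℕ) (L : ℝ) (hL : 1 ≤ L) (hb : Real.log b ≤ L) :
    ∑ p ∈ rkP 0 b, 1 / (p:ℝ) ≤ 18 * Real.log L + 19 := by
  have hl2 := Real.log_two_gt_d9
  have hl2p : 0 < Real.log 2 := by linarith
  have hlL := Real.log_nonneg hL
  rcases Nat.eq_zero_or_pos b with rfl | hb0
  · simp [rkP]; linarith
  have hkc : (0:ℝ) ≤ Real.log L / Real.log 2 := by positivity
  set k := ⌈Real.log L / Real.log 2⌉₊ with hk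
  have hk1 : Real.log L / Real.log 2 ≤ k := Nat.le_ceil _
  have hk2 : (k:ℝ) < Real.log L / Real.log 2 + 1 := Nat.ceil_lt_add_one hkc
  have hLk : L ≤ 2 ^ k := by
    rw [← Real.log_le_log_iff (by positivity) (by positivity), Real.log_pow]
    rwa [div_le_iff₀ hl2p] at hk1
  have hbk : b ≤ 2 ^ (2 ^ (k + 1)) := by
    have : (b:ℝ) ≤ 2 ^ (2 ^ (k + 1)) := by
      rw [← Real.log_le_log_iff (by positivity) (by positivity), Real.log_pow]
      push_cast
      rw [pow_succ]
      nlinarith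
    exact_mod_cast this
  have h1 : ∑ p ∈ rkP 0 b, 1 / (p:ℝ) ≤ ∑ p ∈ rkP 0 (2 ^ (2 ^ (k+1))), 1 / (p:ℝ) := by
    apply Finset.sum_le_sum_of_subset_of_nonneg
    · intro p hp
      obtain ⟨⟨h1, h2⟩, h3⟩ := mem_rkP.1 hp
      exact mem_rkP.2 ⟨⟨by omega, by omega⟩, h3⟩
    · intro p _ _; positivity
  have h2 := rk_mertens3_aux (k+1)
  have h3 : Real.log L / Real.log 2 ≤ 2 * Real.log L := by
    rw [div_le_iff₀ hl2p]; nlinarith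
  push_cast at h2
  linarith

lemma rkP_primesBelow (Y : ℕ) : Nat.primesBelow (Y + 1) = rkP 0 Y := by
  ext p
  rw [mem_rkP, Nat.mem_primesBelow]
  constructor
  · rintro ⟨h, h'⟩; exact ⟨⟨h'.pos, by omega⟩, h'⟩
  · rintro ⟨⟨_, h⟩, h'⟩; exact ⟨by omega, h'⟩

lemma rk_euler (s : ℝ) (hs : 0 < s) (Y : ℕ) (A : Finset ℕ)
    (hA : ∀ n ∈ A, n ∈ Nat.smoothNumbers (Y + 1)) :
    ∑ n ∈ A, (n:ℝ) ^ (-s) ≤ ∏ p ∈ rkP 0 Y, (1 - (p:ℝ) ^ (-s))⁻¹ := by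
  let f : ℕ →* ℝ :=
    { toFun := fun n => (n:ℝ) ^ (-s)
      map_one' := by simp
      map_mul' := fun m n => by
        push_cast
        exact Real.mul_rpow (Nat.cast_nonneg _) (Nat.cast_nonneg _) }
  have hf : ∀ n, f n = (n:ℝ) ^ (-s) := fun _ => rfl
  have h := (EulerProduct.summable_and_hasSum_smoothNumbers_prod_primesBelow_geometric (f := f)
    (fun {p} hp => by
      rw [hf, Real.norm_of_nonneg (by positivity)]
      exact Real.rpow_lt_one_of_one_lt_of_neg (by exact_mod_cast hp.one_lt) (by linarith)) (Y + 1)).2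
  rw [rkP_primesBelow] at h
  change HasSum (f ∘ ((↑) : (Nat.smoothNumbers (Y + 1)) → ℕ)) _ at h
  rw [hasSum_subtype_iff_indicator] at h
  have h2 := sum_le_hasSum A (fun n _ => Set.indicator_nonneg
    (fun m _ => by rw [hf]; positivity) n) h
  refine le_trans (le_of_eq ?_) h2
  apply Finset.sum_congr rfl
  intro n hn
  rw [Set.indicator_of_mem (hA n hn), hf]

lemma rk_mertens_prod (Y : ℕ) :
    (∏ p ∈ rkP 0 Y, (1 - 1 / (p:ℝ))) * Real.log (Y + 1) ≤ 1 := by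
  have h := rk_euler 1 one_pos Y (Finset.Icc 1 Y) (fun n hn => by
    rw [Finset.mem_Icc] at hn
    exact Nat.mem_smoothNumbers_of_lt hn.1 (by omega))
  have h1 := log_add_one_le_harmonic Y
  rw [harmonic_eq_sum_Icc] at h1
  push_cast at h1
  simp only [Real.rpow_neg_one] at h
  rw [Finset.prod_inv_distrib] at h
  have hpos : 0 < ∏ p ∈ rkP 0 Y, (1 - ((p:ℝ))⁻¹) := by
    apply Finset.prod_pos
    intro p hp
    have := (mem_rkP.1 hp).2.one_lt
    have h2 : (1:ℝ) < p := by exact_mod_cast this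
    rw [sub_pos]; exact inv_lt_one_of_one_lt₀ h2
  have h3 := h1.trans h
  simp only [one_div]
  calc _ ≤ (∏ p ∈ rkP 0 Y, (1 - ((p:ℝ))⁻¹)) * (∏ p ∈ rkP 0 Y, (1 - ((p:ℝ))⁻¹))⁻¹ := by gcongr
    _ = 1 := mul_inv_cancel₀ hpos.ne'

lemma rk_smooth (η : ℝ) (h0 : 0 < η) (h1 : η ≤ 1 / 2) (Y M : ℕ) :
    (((Finset.Icc 1 M).filter (fun n => n ∈ Nat.smoothNumbers (Y+1))).card : ℝ) ≤
      (M:ℝ) ^ (1 - η) * Real.exp (4 * ∑ p ∈ rkP 0 Y, (p:ℝ) ^ (η - 1)) := by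
  set A := (Finset.Icc 1 M).filter (fun n => n ∈ Nat.smoothNumbers (Y+1)) with hA
  have he := rk_euler (1 - η) (by linarith) Y A (fun n hn => (Finset.mem_filter.1 hn).2)
  have hc : (A.card : ℝ) ≤ (M:ℝ) ^ (1 - η) * ∑ n ∈ A, (n:ℝ) ^ (-(1 - η)) := by
    rw [Finset.mul_sum, Finset.card_eq_sum_ones, Nat.cast_sum]
    apply Finset.sum_le_sum
    intro n hn
    have hn' := Finset.mem_Icc.1 (Finset.mem_filter.1 hn).1
    have hn0 : (0:ℝ) < n := by exact_mod_cast hn'.1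
    have hM : (n:ℝ) ≤ M := by exact_mod_cast hn'.2
    rw [Real.rpow_neg hn0.le, ← div_eq_mul_inv, le_div_iff₀ (by positivity)]
    push_cast
    rw [one_mul]
    exact Real.rpow_le_rpow hn0.le hM (by linarith)
  have hp : ∏ p ∈ rkP 0 Y, (1 - (p:ℝ) ^ (-(1 - η)))⁻¹ ≤
      Real.exp (4 * ∑ p ∈ rkP 0 Y, (p:ℝ) ^ (η - 1)) := by
    rw [Finset.mul_sum, Real.exp_sum]
    apply Finset.prod_le_prod
    · intro p hp
      have := (mem_rkP.1 hp).2.one_lt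
      have h2 : (1:ℝ) < p := by exact_mod_cast this
      rw [inv_nonneg, sub_nonneg]
      exact (Real.rpow_lt_one_of_one_lt_of_neg h2 (by linarith)).le
    · intro p hp
      have := (mem_rkP.1 hp).2.two_le
      have h2 : (2:ℝ) ≤ p := by exact_mod_cast this
      rw [neg_sub]
      set t := (p:ℝ) ^ (η - 1) with ht
      have ht0 : 0 < t := by positivity
      have ht1 : t ≤ 3 / 4 := by
        have e1 : t ≤ (p:ℝ) ^ (-(1/2) : ℝ) :=
          Real.rpow_le_rpow_of_exponent_le (by linarith) (by linarith)
        have e2 : (p:ℝ) ^ (-(1/2) : ℝ) ≤ (2:ℝ) ^ (-(1/2) : ℝ) :=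
          Real.rpow_le_rpow_of_nonpos (by norm_num) h2 (by norm_num)
        have e3 : (2:ℝ) ^ (-(1/2) : ℝ) ≤ 3 / 4 := by
          rw [Real.rpow_neg (by norm_num), ← Real.sqrt_eq_rpow]
          rw [inv_le_comm₀ (by positivity) (by norm_num)]
          apply Real.le_sqrt_of_sq_le; norm_num
        linarith
      rw [inv_le_comm₀ (by linarith) (Real.exp_pos _), ← Real.exp_neg]
      -- exp(-4t) ≤ 1 - t
      have e4 : Real.exp (-(4 * t)) = (Real.exp (4 * t))⁻¹ := Real.exp_neg _
      rw [e4, inv_le_comm₀ (Real.exp_pos _) (by linarith)]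
      have e5 := Real.add_one_le_exp (4 * t)
      refine le_trans ?_ e5
      rw [inv_le_iff_one_le_mul₀ (by linarith)]
      nlinarith
  calc _ ≤ _ := hc
    _ ≤ _ := by gcongr; exact he.trans hp

lemma rk_rpow_sum (η T B : ℝ) (hη : 0 < η) (hT : 0 < T) (Y : ℕ) (hY : η * Real.log Y ≤ T)
    (h1 : ∑ p ∈ rkP 0 Y, 1 / (p:ℝ) ≤ B) (D : ℝ) (hD : ∑ p ∈ rkP 0 Y, Real.log p / p ≤ D) :
    ∑ p ∈ rkP 0 Y, (p:ℝ) ^ (η - 1) ≤ B + Real.exp T / T * η * D := by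
  have h2 : ∑ p ∈ rkP 0 Y, (p:ℝ) ^ (η - 1) ≤
      ∑ p ∈ rkP 0 Y, (1 / (p:ℝ) + Real.exp T / T * η * (Real.log p / p)) := by
    apply Finset.sum_le_sum
    intro p hp
    obtain ⟨⟨_, hpY⟩, hpp⟩ := mem_rkP.1 hp
    have hp0 : (0:ℝ) < p := by exact_mod_cast hpp.pos
    have hlp : 0 ≤ Real.log p := Real.log_natCast_nonneg p
    have hle : Real.log p ≤ Real.log Y := Real.log_le_log hp0 (by exact_mod_cast hpY)
    have ht : η * Real.log p ≤ T := le_trans (by gcongr) hY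
    have hc := convexOn_exp.2 (Set.mem_univ (0:ℝ)) (Set.mem_univ T)
      (show (0:ℝ) ≤ 1 - η * Real.log p / T by rw [sub_nonneg, div_le_one hT]; exact ht)
      (show (0:ℝ) ≤ η * Real.log p / T by positivity) (by ring)
    simp only [smul_eq_mul, mul_zero, zero_add, Real.exp_zero, mul_one] at hc
    rw [div_mul_cancel₀ _ hT.ne'] at hc
    have hb : (0:ℝ) ≤ η * Real.log p / T := by positivity
    have e : (p:ℝ) ^ (η - 1) = Real.exp (η * Real.log p) / p := by
      rw [Real.rpow_sub hp0, Real.rpow_one, Real.rpow_def_of_pos hp0, mul_comm η]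
    have e2 : 1 / (p:ℝ) + Real.exp T / T * η * (Real.log p / p) =
      (1 + η * Real.log p / T * Real.exp T) / p := by field_simp
    rw [e, e2]
    gcongr
    linarith
  rw [Finset.sum_add_distrib, ← Finset.mul_sum] at h2
  refine h2.trans ?_
  gcongr

lemma rk_card (Z N : ℕ) (h : Z ≤ N) :
    (Nat.primeCounting N : ℝ) - Z ≤ (rkP Z N).card := by
  have h1 := rkP_sum_split (fun _ => 1) 0 Z N (by omega) h
  simp only [Finset.sum_const, nsmul_eq_mul, mul_one] at h1
  have h2 : (rkP 0 N).card = Nat.primeCounting N := by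
    rw [← rkP_primesBelow, Nat.primesBelow_card_eq_primeCounting']; rfl
  have h3 : (rkP 0 Z).card ≤ Z := by
    refine (Finset.card_filter_le _ _).trans ?_
    simp
  have h4 : ((rkP 0 Z).card : ℝ) ≤ Z := by exact_mod_cast h3
  rw [h2] at h1
  linarith

lemma rk_pi_aux (x L : ℝ) (hx : 0 < x) (hL : L = Real.log x) (hL3 : 30000 ≤ L) (hx100 : 100 * L ≤ x)
    (Z N : ℕ) (hN : N = ⌊x⌋₊) (hZN : Z ≤ N) (hZz : (Z:ℝ) ≤ x / L ^ 2) :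
    x / (4 * L) ≤ (rkP Z N).card := by
  have hL0 : 0 < L := by linarith
  have hl2 := Real.log_two_gt_d9
  have h1 := rk_card Z N hZN
  have h2 := Chebyshev.pi_ge' (x := x) (by linarith)
  rw [← hN, ← hL] at h2
  have h3 : x / (2 * L) ≤ ((x - 1) * Real.log 2 - Real.log (x + 2)) / L := by
    rw [div_le_div_iff₀ (by positivity) hL0]
    have h4 : Real.log (x + 2) ≤ 2 * L := by
      have h0 : x + 2 ≤ x ^ 2 := by
        have := mul_le_mul_of_nonneg_right (show (2:ℝ) ≤ x by linarith) hx.le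
        rw [sq]; linarith
      have : Real.log (x + 2) ≤ Real.log (x ^ 2) :=
        Real.log_le_log (by positivity) h0
      rw [Real.log_pow, ← hL] at this; exact_mod_cast this
    have h5 : x / 2 ≤ (x - 1) * Real.log 2 - Real.log (x + 2) := by
      have := mul_le_mul_of_nonneg_left (show (0.69:ℝ) ≤ Real.log 2 by linarith)
        (show 0 ≤ x - 1 by linarith)
      linarith
    have h6 := mul_le_mul_of_nonneg_right h5 (show 0 ≤ 2 * L by linarith)
    linarith
  have h6 : x / L ^ 2 ≤ x / (4 * L) := by
    apply div_le_div_of_nonneg_left hx.le (by positivity)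
    have := mul_le_mul_of_nonneg_right (show (4:ℝ) ≤ L by linarith) hL0.le
    rw [sq]; linarith
  have h7 : x / (2 * L) = x / (4 * L) + x / (4 * L) := by field_simp; norm_num
  linarith

set_option maxHeartbeats 2000000 in
lemma rk_main (x L w v U : ℝ) (hx : 0 < x) (hL : L = Real.log x) (hw : w = Real.log L)
    (hv : v = Real.log w) (hU : U = x * L * v / (30000 * w ^ 2))
    (hL0 : 0 < L) (hw1 : 1 ≤ w) (hv1 : 1 ≤ v) (hwL : 30000 * w ^ 2 ≤ L) :
    U ≤ x * L ∧ ∃ a : ℕ → ℕ, ∀ n ∈ Finset.Icc 1 ⌊U⌋₊, ∃ p ∈ rkP 0 ⌊x⌋₊, n ≡ a p [MOD p] := by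
  have hxe : x = Real.exp L := by rw [hL, Real.exp_log hx]
  have hLe : L = Real.exp w := by rw [hw, Real.exp_log hL0]
  have hwe : w = Real.exp v := by rw [hv, Real.exp_log (by linarith)]
  have hw0 : 0 < w := by linarith
  have hv0 : 0 < v := by linarith
  have hvw : v ≤ w := by have := Real.add_one_le_exp v; linarith
  have hww : w ≤ w ^ 2 := by rw [sq]; exact le_mul_of_one_le_right hw0.le hw1
  have hL3 : 30000 ≤ L := by linarith
  have hwL' : 30000 * w ≤ L := by linarith
  have hl2 := Real.log_two_gt_d9
  have hl2' := Real.log_two_lt_d9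
  have hx2 : L ^ 2 / 2 ≤ x := by
    have := Real.quadratic_le_exp_of_nonneg hL0.le
    rw [← hxe] at this; linarith
  have hx100 : 100 * L ≤ x := by
    have := mul_le_mul_of_nonneg_right (show (200:ℝ) ≤ L by linarith) hL0.le
    rw [sq] at hx2; linarith
  -- bounds on U
  have hUx : x ≤ U := by
    rw [hU, le_div_iff₀ (by positivity)]
    have : 30000 * w ^ 2 ≤ L * v := hwL.trans (le_mul_of_one_le_right hL0.le hv1)
    have := mul_le_mul_of_nonneg_left this hx.le
    linarith
  have hUL : U ≤ x * L := by
    rw [hU, div_le_iff₀ (by positivity)]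
    have : v ≤ 30000 * w ^ 2 := by linarith
    have hxL : 0 < x * L := by positivity
    exact mul_le_mul_of_nonneg_left this hxL.le
  refine ⟨hUL, ?_⟩
  have hU0 : 0 < U := by linarith
  set ly := L * v / (177 * w) with hly
  have hly0 : 0 < ly := by positivity
  have hly1 : 1 ≤ ly := by
    rw [hly, le_div_iff₀ (by positivity)]
    have := le_mul_of_one_le_right hL0.le hv1
    linarith
  have hlyL : ly ≤ L / 4 := by
    rw [hly, div_le_iff₀ (by positivity)]
    have := mul_le_mul_of_nonneg_left hvw hL0.le
    have : 0 < L * w := by positivity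
    linarith
  set y := Real.exp ly with hy
  have hy1 : 1 ≤ y := Real.one_le_exp hly0.le
  set z := x / L ^ 2 with hz
  have hlogz : Real.log z = L - 2 * w := by
    rw [hz, Real.log_div hx.ne' (by positivity), Real.log_pow, ← hL, ← hw]; norm_num
  have hz0 : 0 < z := by positivity
  have hyz : y ≤ z := by
    rw [hy, ← Real.le_log_iff_exp_le hz0, hlogz]; linarith
  have hz4 : 4 ≤ z := by
    have := Real.add_one_le_exp ly
    have h5 : Real.exp (L / 2) ≤ z := by
      rw [← Real.le_log_iff_exp_le hz0, hlogz]; linarith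
    have := Real.add_one_le_exp (L / 2)
    linarith
  have hzx : z ≤ x := by
    rw [hz, div_le_iff₀ (by positivity)]
    exact le_mul_of_one_le_right hx.le (one_le_pow₀ (by linarith))
  set Y := ⌊y⌋₊ with hY
  set Z := ⌊z⌋₊ with hZ
  set N := ⌊x⌋₊ with hN
  set M := ⌊U⌋₊ with hM
  have hYZ : Y ≤ Z := Nat.floor_mono hyz
  have hZN : Z ≤ N := Nat.floor_mono hzx
  have hZM : Z ≤ M := Nat.floor_mono (hzx.trans hUx)
  have hY1 : 1 ≤ Y := Nat.one_le_floor_iff _ |>.2 hy1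
  have hYy : (Y:ℝ) ≤ y := Nat.floor_le (by linarith)
  have hMU : (M:ℝ) ≤ U := Nat.floor_le hU0.le
  have hZz : (Z:ℝ) ≤ z := Nat.floor_le hz0.le
  have hZz' : z / 2 ≤ Z := by
    have := Nat.lt_floor_add_one z
    rw [← hZ] at this; linarith
  have hZ2 : 2 ≤ Z := by
    have : (2:ℝ) ≤ Z := by linarith
    exact_mod_cast this
  have hY0 : (0:ℝ) < Y := by exact_mod_cast hY1
  have hlogY : Real.log Y ≤ ly := by
    have := Real.log_le_log hY0 hYy
    rwa [hy, Real.log_exp] at this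
  apply rk_cover Y Z N M hYZ hZN
  -- smooth part
  set η := 177 * w / L with hη
  have hη0 : 0 < η := by positivity
  have hη1 : η ≤ 1 / 2 := by rw [hη, div_le_iff₀ hL0]; linarith
  have hηly : η * ly = v := by rw [hη, hly]; field_simp
  have hsum : ∑ p ∈ rkP 0 Y, (p:ℝ) ^ (η - 1) ≤ 44 * w := by
    have h1 := rk_mertens3 Y L (by linarith) (by linarith)
    have h2 := rk_mertens1 1 Y le_rfl hY1
    rw [← rkP_zero_one] at h2
    have h3 := rk_rpow_sum η v _ hη0 hv0 Y (by rw [← hηly]; gcongr) h1 _ h2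
    rw [← hw, ← hwe, Nat.cast_one, div_one] at h3
    have h4 : w / v * η * (4 * Real.log Y + 3) ≤ w / v * η * (7 * ly) := by
      gcongr; linarith
    have h5 : w / v * η * (7 * ly) = 7 * w := by
      calc w / v * η * (7 * ly) = w / v * 7 * (η * ly) := by ring
        _ = 7 * w := by rw [hηly]; field_simp
    linarith
  have hsm : (((Finset.Icc 1 M).filter (fun n => n ∈ Nat.smoothNumbers (Y+1))).card : ℝ) ≤ U / L := by
    refine (rk_smooth η hη0 hη1 Y M).trans ?_
    have h1 : (M:ℝ) ^ (1 - η) ≤ U * Real.exp (-(177 * w)) := by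
      calc (M:ℝ) ^ (1 - η) ≤ U ^ (1 - η) := Real.rpow_le_rpow (Nat.cast_nonneg _) hMU (by linarith)
        _ = U * U ^ (-η) := by
          rw [sub_eq_add_neg, Real.rpow_add hU0, Real.rpow_one]
        _ ≤ U * x ^ (-η) := by
          gcongr 1
          exact Real.rpow_le_rpow_of_nonpos hx hUx (by linarith)
        _ = _ := by
          rw [Real.rpow_def_of_pos hx, ← hL, hη]
          congr 2; field_simp
    calc _ ≤ (U * Real.exp (-(177 * w))) * Real.exp (4 * (44 * w)) := by gcongr
      _ = U / L := by
        rw [mul_assoc, ← Real.exp_add, div_eq_mul_inv]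
        have hLi : L⁻¹ = Real.exp (-w) := by rw [Real.exp_neg, ← hLe]
        rw [hLi]; congr 2; ring
  -- large prime part
  have hlogZ : L / 2 ≤ Real.log Z := by
    have h1 : Real.log (z / 2) ≤ Real.log Z := Real.log_le_log (by positivity) hZz'
    rw [Real.log_div hz0.ne' (by norm_num), hlogz] at h1
    linarith
  have hlogMZ : Real.log ((M:ℝ) / Z) ≤ 4 * w := by
    have hZ0 : (0:ℝ) < Z := by linarith
    have hM0 : (0:ℝ) < M := by
      have : (Z:ℝ) ≤ M := by exact_mod_cast hZM
      linarith
    have : (M:ℝ) / Z ≤ L ^ 4 := by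
      rw [div_le_iff₀ hZ0]
      have e1 : L ^ 4 * (z / 2) = x * L * L / 2 := by rw [hz]; field_simp
      have e2 : L ^ 4 * (z / 2) ≤ L ^ 4 * Z := by gcongr
      have e3 : x * L ≤ x * L * L / 2 := by
        have h0 : 0 < x * L := by positivity
        have h1 := mul_le_mul_of_nonneg_left (show (1:ℝ) ≤ L / 2 by linarith) h0.le
        linarith
      linarith
    have h2 := Real.log_le_log (by positivity) this
    rw [Real.log_pow, ← hw] at h2
    exact_mod_cast h2
  have hlarge : ∑ p ∈ rkP Z M, (M:ℝ) / p ≤ U * (38 * w / L) := by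
    have e : ∑ p ∈ rkP Z M, (M:ℝ) / p = M * ∑ p ∈ rkP Z M, 1 / (p:ℝ) := by
      rw [Finset.mul_sum]; apply Finset.sum_congr rfl; intro p _; ring
    rw [e]
    have h1 := rk_mertens2 Z M hZ2 hZM
    have h2 : (4 * Real.log ((M:ℝ) / Z) + 3) / Real.log Z ≤ 38 * w / L := by
      rw [div_le_div_iff₀ (by linarith) hL0]
      have : (4 * Real.log ((M:ℝ) / Z) + 3) * L ≤ (19 * w) * L := by
        exact mul_le_mul_of_nonneg_right (by linarith) hL0.le
      have h4 := mul_le_mul_of_nonneg_left hlogZ (show 0 ≤ 38 * w by linarith)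
      linarith
    have h3 : (0:ℝ) ≤ ∑ p ∈ rkP Z M, 1 / (p:ℝ) := Finset.sum_nonneg (fun p _ => by positivity)
    exact mul_le_mul hMU (h1.trans h2) h3 hU0.le
  -- product
  have hprod : ∏ p ∈ rkP 0 Y, (1 - 1 / (p:ℝ)) ≤ 1 / ly := by
    have h1 := rk_mertens_prod Y
    have h2 : ly ≤ Real.log (Y + 1) := by
      rw [Real.le_log_iff_exp_le (by positivity)]
      exact (Nat.lt_floor_add_one y).le
    rw [le_div_iff₀ hly0]
    refine le_trans ?_ h1
    gcongr
    apply Finset.prod_nonneg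
    intro p hp
    have := (mem_rkP.1 hp).2
    have hp0 : (0:ℝ) < p := by exact_mod_cast this.pos
    rw [sub_nonneg, div_le_one hp0]; exact_mod_cast this.one_le
  have hprod0 : 0 ≤ ∏ p ∈ rkP 0 Y, (1 - 1 / (p:ℝ)) := by
    apply Finset.prod_nonneg
    intro p hp
    have := (mem_rkP.1 hp).2
    have hp0 : (0:ℝ) < p := by exact_mod_cast this.pos
    rw [sub_nonneg, div_le_one hp0]; exact_mod_cast this.one_le
  -- number of available primes
  have hcard : x / (4 * L) ≤ (rkP Z N).card :=
    rk_pi_aux x L hx hL hL3 hx100 Z N hN hZN hZz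
  calc _ ≤ (U / L + U * (38 * w / L)) * (1 / ly) := by gcongr
    _ ≤ (U * (39 * w / L)) * (1 / ly) := by
      gcongr
      have : U / L ≤ U * (w / L) := by
        rw [← mul_div_assoc]
        exact div_le_div_of_nonneg_right (le_mul_of_one_le_right hU0.le hw1) hL0.le
      have e : U * (39 * w / L) = U * (w / L) + U * (38 * w / L) := by ring
      linarith
    _ = (39 * 177 / 30000) * (x / L) := by
      rw [hU, hly]; field_simp
    _ ≤ x / (4 * L) := by
      have : x / (4 * L) = (1 / 4) * (x / L) := by field_simp
      rw [this]; exact mul_le_mul_of_nonneg_right (by norm_num) (by positivity)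
    _ ≤ _ := hcard

lemma rk_final (X A B C D : ℝ) (hX : 0 < X) (hA : A = Real.log X) (hB : B = Real.log A)
    (hC : C = Real.log B) (hD : D = Real.log C) (hA1 : 40 ≤ A) (hB1 : 4 ≤ B) (hC1 : 4 ≤ C)
    (hD1 : 4 ≤ D) (hBC : 60000 * C ^ 2 ≤ B) :
    1 / 480000 * (A * B * D) / C ^ 2 ≤ G X := by
  have hl2 := Real.log_two_gt_d9
  have hl2' := Real.log_two_lt_d9
  have hl4 : Real.log 4 = 2 * Real.log 2 := by
    rw [show (4:ℝ) = 2 ^ 2 by norm_num, Real.log_pow]; norm_num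
  set x := A / 4 with hx
  set L := Real.log x with hL
  set w := Real.log L with hw
  set v := Real.log w with hv
  have hx0 : 0 < x := by positivity
  have hLB : L = B - Real.log 4 := by
    rw [hL, hx, Real.log_div (by positivity) (by norm_num), ← hB]
  have hL1 : B / 2 ≤ L := by linarith
  have hL2 : L ≤ B := by linarith
  have hL0 : 0 < L := by linarith
  have hw1 : C / 2 ≤ w := by
    have := Real.log_le_log (by positivity) hL1
    rw [Real.log_div (by positivity) (by norm_num), ← hC, ← hw] at this
    linarith
  have hw2 : w ≤ C := by
    have := Real.log_le_log hL0 hL2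
    rwa [← hC, ← hw] at this
  have hw0 : 0 < w := by linarith
  have hv1 : D / 2 ≤ v := by
    have := Real.log_le_log (by positivity) hw1
    rw [Real.log_div (by positivity) (by norm_num), ← hD, ← hv] at this
    linarith
  have hwC : w ^ 2 ≤ C ^ 2 := by gcongr
  set U := x * L * v / (30000 * w ^ 2) with hU
  obtain ⟨hUL, a, ha⟩ := rk_main x L w v U hx0 hL hw hv hU hL0 (by linarith) (by linarith)
    (by linarith)
  obtain ⟨m, hm2, hm, hcomp⟩ := rk_crt ⌊x⌋₊ ⌊U⌋₊ (Nat.le_floor (by push_cast; linarith)) a ha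
  have hv0 : 0 < v := by linarith
  have hU0 : 0 ≤ U := by positivity
  have hexp : X = Real.exp (4 * x) := by
    rw [hx, show 4 * (A / 4) = A by ring, hA, Real.exp_log hX]
  have hx10 : 10 ≤ x := by linarith
  have h4N : (4:ℝ) ^ ⌊x⌋₊ ≤ Real.exp (2 * x) := by
    have h1 : ((⌊x⌋₊ : ℕ) : ℝ) ≤ x := Nat.floor_le hx0.le
    rw [← Real.log_le_iff_le_exp (by positivity), Real.log_pow, hl4]
    nlinarith
  have hUe : U ≤ Real.exp (2 * x) := by
    have h1 := Real.add_one_le_exp x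
    have h2 := Real.log_le_sub_one_of_pos hx0
    have h3 : Real.exp (2 * x) = Real.exp x * Real.exp x := by rw [← Real.exp_add]; ring_nf
    rw [h3]
    refine hUL.trans ?_
    exact mul_le_mul (by linarith) (by linarith) hL0.le (Real.exp_pos _).le
  have hbig : (2 * ((m:ℝ) + (⌊U⌋₊ : ℕ))) ≤ X := by
    have h1 : ((⌊U⌋₊ : ℕ) : ℝ) ≤ U := Nat.floor_le hU0
    have h2 : (m:ℝ) ≤ 2 * 4 ^ ⌊x⌋₊ := by exact_mod_cast hm
    have h3 : X = Real.exp (2 * x) * Real.exp (2 * x) := by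
      rw [hexp, ← Real.exp_add]; ring_nf
    have h4 := Real.add_one_le_exp (2 * x)
    have h5 : 6 * Real.exp (2 * x) ≤ Real.exp (2 * x) * Real.exp (2 * x) :=
      mul_le_mul_of_nonneg_right (by linarith) (Real.exp_pos _).le
    linarith
  have hg := rk_gap m ⌊U⌋₊ X hm2 hbig hcomp
  have hUM := (Nat.lt_floor_add_one U).le
  refine le_trans ?_ (hUM.trans hg)
  calc 1 / 480000 * (A * B * D) / C ^ 2 = (A / 4) * (B / 2) * (D / 2) / (30000 * C ^ 2) := by
        field_simp; norm_num
    _ ≤ x * L * v / (30000 * w ^ 2) := by gcongr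
    _ = U := rfl

/-- (Rankin, 1938) `G(X) ≥ (c + o(1)) · log X · log₂ X · log₄ X / (log₃ X)²`. -/
theorem rankin_large_gaps :
    ∃ c > (0 : ℝ), ∀ ε > (0 : ℝ), ∃ X₀ : ℝ, ∀ X ≥ X₀,
      G X ≥ (c - ε) * (Real.log X * iterlog 2 X * iterlog 4 X) / (iterlog 3 X) ^ 2 := by
  refine ⟨1 / 480000, by norm_num, fun ε hε => ?_⟩
  have t1 := Real.tendsto_log_atTop
  have t2 := t1.comp t1
  have t3 := t1.comp t2
  have t4 := t1.comp t3
  have hsq : ∀ᶠ b : ℝ in atTop, 60000 * (Real.log b) ^ 2 ≤ b := by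
    have h := (isLittleO_pow_log_id_atTop (n := 2)).bound (c := 1 / 60000) (by norm_num)
    filter_upwards [h, eventually_ge_atTop 0] with b hb hb0
    rw [Real.norm_of_nonneg (by positivity), id, Real.norm_of_nonneg hb0] at hb
    linarith
  have hev : ∀ᶠ X : ℝ in atTop, G X ≥ (1 / 480000 - ε) *
      (Real.log X * iterlog 2 X * iterlog 4 X) / (iterlog 3 X) ^ 2 := by
    filter_upwards [eventually_gt_atTop 0, t1.eventually_ge_atTop 40, t2.eventually_ge_atTop 4,
      t3.eventually_ge_atTop 4, t4.eventually_ge_atTop 4, t2.eventually hsq] with X h0 h1 h2 h3 h4 h5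
    simp only [Function.comp_apply] at h1 h2 h3 h4 h5
    have h := rk_final X _ _ _ _ h0 rfl rfl rfl rfl h1 h2 h3 h4 h5
    simp only [iterlog]
    refine le_trans ?_ h
    have : 1 / 480000 - ε ≤ 1 / 480000 := by linarith
    gcongr
  obtain ⟨X₀, h⟩ := eventually_atTop.1 hev
  exact ⟨X₀, h⟩
end
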